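/- arXiv:2510.07647 — 9 statements merged into one kernel-verified Lean document; each statement's English description precedes it below -/
import Mathlib

section
/- Let a : ℕ → ℝ satisfy a(0) = 1 and the Hecke recursion a(1)·a(r) = a(r+1) + a(r−1) for every integer r ≥ 1. Then for every integer m ≥ 0, a(1)^{2m} = Σ_{r=0}^{m} ( C(2m, m−r) − C(2m, m−r−1) ) · a(2r), where C(n,j) denotes the binomial coefficient, with the convention C(n,j) = 0 when j < 0. -/
/-- Binomial coefficient with an integer lower argument, with the convention that it
vanishes for negative lower argument. -/
noncomputable def binomInt (n : ℕ) (j : ℤ) : ℝ :=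
  if 0 ≤ j then (n.choose j.toNat : ℝ) else 0

lemma binomInt_nat (n k : ℕ) : binomInt n (k : ℤ) = (n.choose k : ℝ) := by
  simp [binomInt]

lemma binomInt_neg (n : ℕ) (j : ℤ) (h : j < 0) : binomInt n j = 0 := by
  simp [binomInt, h]

lemma binomInt_succ (n : ℕ) (j : ℤ) :
    binomInt (n + 1) j = binomInt n j + binomInt n (j - 1) := by
  rcases lt_trichotomy j 0 with h | h | h
  · rw [binomInt_neg _ _ h, binomInt_neg _ _ h, binomInt_neg _ _ (by omega)]; simp
  · subst h
    rw [binomInt_neg n (0 - 1) (by omega)]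
    simp [binomInt]
  · obtain ⟨k, rfl⟩ : ∃ k : ℕ, j = ((k + 1 : ℕ) : ℤ) := ⟨(j - 1).toNat, by omega⟩
    have e : ((k + 1 : ℕ) : ℤ) - 1 = (k : ℤ) := by push_cast; ring
    rw [e, binomInt_nat, binomInt_nat, binomInt_nat, Nat.choose_succ_succ]
    push_cast; ring

lemma binomInt_symm (m : ℕ) : binomInt (2 * m) ((m : ℤ) + 1) = binomInt (2 * m) ((m : ℤ) - 1) := by
  have e : (m : ℤ) + 1 = ((m + 1 : ℕ) : ℤ) := by push_cast; ring
  rw [e, binomInt_nat]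
  cases m with
  | zero => rw [binomInt_neg _ _ (by simp)]; simp
  | succ k =>
    have e2 : ((k + 1 : ℕ) : ℤ) - 1 = (k : ℤ) := by push_cast; ring
    rw [e2, binomInt_nat, Nat.choose_symm_of_eq_add (by omega : 2 * (k + 1) = (k + 1 + 1) + k)]

lemma hecke_sum (x : ℝ) (b d e : ℕ → ℝ) (hb0 : x ^ 2 * b 0 = b 1 + b 0)
    (hb : ∀ r, x ^ 2 * b (r + 1) = b (r + 2) + 2 * b (r + 1) + b r)
    (he0 : e 0 = d 0 + d 1) (he : ∀ r, e (r + 1) = d r + 2 * d (r + 1) + d (r + 2)) (N : ℕ) :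
    x ^ 2 * ∑ r ∈ Finset.range (N + 1), d r * b r =
      ∑ r ∈ Finset.range (N + 1), e r * b r + d N * b (N + 1) - d (N + 1) * b N := by
  induction N with
  | zero => simp [he0]; linear_combination d 0 * hb0
  | succ N ih =>
    rw [Finset.sum_range_succ, Finset.sum_range_succ (fun r => e r * b r), mul_add, ih, he]
    linear_combination d (N + 1) * hb N

/-- **Even powers of a Hecke eigenvalue.**
If `a : ℕ → ℝ` satisfies `a 0 = 1` and the Hecke recursion
`a 1 * a r = a (r+1) + a (r-1)` for `r ≥ 1`, then for every `m ≥ 0`,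
`a(1)^{2m} = Σ_{r=0}^{m} (C(2m, m-r) - C(2m, m-r-1)) a(2r)`,
with the convention `C(n,j) = 0` for `j < 0`. -/
theorem pow_even_eq_sum_hecke
    (a : ℕ → ℝ) (h0 : a 0 = 1)
    (hrec : ∀ r : ℕ, 1 ≤ r → a 1 * a r = a (r + 1) + a (r - 1)) (m : ℕ) :
    (a 1) ^ (2 * m) =
      ∑ r ∈ Finset.range (m + 1),
        (binomInt (2 * m) ((m : ℤ) - r) - binomInt (2 * m) ((m : ℤ) - r - 1)) * a (2 * r) := by
  induction m with
  | zero => simp [binomInt, h0]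
  | succ m ih =>
    have hs : ∀ j : ℤ, binomInt (2 * (m + 1)) j =
        binomInt (2 * m) j + 2 * binomInt (2 * m) (j - 1) + binomInt (2 * m) (j - 2) := by
      intro j
      rw [show 2 * (m + 1) = 2 * m + 1 + 1 by ring, binomInt_succ, binomInt_succ, binomInt_succ,
        show j - 1 - 1 = j - 2 by ring]
      ring
    have h1 : a 1 * a 1 = a 2 + a 0 := hrec 1 le_rfl
    have key := hecke_sum (a 1) (fun r => a (2 * r))
      (fun r => binomInt (2 * m) ((m : ℤ) - r) - binomInt (2 * m) ((m : ℤ) - r - 1))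
      (fun r => binomInt (2 * (m + 1)) (((m + 1 : ℕ) : ℤ) - r)
        - binomInt (2 * (m + 1)) (((m + 1 : ℕ) : ℤ) - r - 1))
      (by simp only [mul_zero, mul_one, h0] at h1 ⊢; linear_combination h1)
      (by
        intro r
        have e1 : a 1 * a (2 * r + 2) = a (2 * r + 3) + a (2 * r + 1) := hrec (2 * r + 2) (by omega)
        have e2 : a 1 * a (2 * r + 3) = a (2 * r + 4) + a (2 * r + 2) := hrec (2 * r + 3) (by omega)
        have e3 : a 1 * a (2 * r + 1) = a (2 * r + 2) + a (2 * r) := hrec (2 * r + 1) (by omega)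
        simp only [mul_add, mul_one, Nat.reduceMul]
        linear_combination a 1 * e1 + e2 + e3)
      (by
        have := binomInt_symm m
        simp only [hs]
        push_cast
        ring_nf at this ⊢
        linear_combination this)
      (by
        intro r
        simp only [hs]
        push_cast
        ring_nf)
      m
    rw [show 2 * (m + 1) = 2 * m + 2 by ring, pow_add, ih, mul_comm, key,
      Finset.sum_range_succ _ (m + 1)]
    have z : ∀ j : ℤ, j < 0 → binomInt (2 * m) j = 0 := fun j h => binomInt_neg _ _ h
    have z' : ∀ j : ℤ, j < 0 → binomInt (2 * m + 2) j = 0 := fun j h => binomInt_neg _ _ h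
    simp only [show 2 * (m + 1) = 2 * m + 2 by ring]
    rw [z ((m : ℤ) - m - 1) (by omega), z ((m : ℤ) - (m + 1 : ℕ)) (by omega),
      z ((m : ℤ) - (m + 1 : ℕ) - 1) (by omega), z' (((m + 1 : ℕ) : ℤ) - (m + 1 : ℕ) - 1) (by omega)]
    simp [binomInt]
end

section
/- Let k be a positive even integer and let μ ∈ ℂ be such that neither (μ + k − 1)/2 nor (−μ + k − 1)/2 is a nonpositive integer. Then 𝒢_{μ,k−1}(0) = 𝒢_{−μ,k−1}(0). -/
open Complex

/-- The function `𝒢_{μ,ν}(s) = Γ((μ+ν+s)/2) Γ⁻¹((μ-ν-s)/2+1) Γ⁻¹((ν-μ-s)/2+1) Γ⁻¹((μ+ν-s)/2+1)`,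
where `Γ⁻¹` denotes the reciprocal Gamma function (which vanishes at the nonpositive
integers; note that Mathlib's `Complex.Gamma` takes the value `0` at its poles, so its
pointwise inverse is the entire reciprocal Gamma function). -/
noncomputable def calG (μ ν s : ℂ) : ℂ :=
  Complex.Gamma ((μ + ν + s) / 2) * (Complex.Gamma ((μ - ν - s) / 2 + 1))⁻¹ *
    (Complex.Gamma ((ν - μ - s) / 2 + 1))⁻¹ * (Complex.Gamma ((μ + ν - s) / 2 + 1))⁻¹

lemma calG_aux (a b : ℂ) (ha : a ≠ 0) (hb : b ≠ 0) (hG : Complex.Gamma a ≠ 0) :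
    Complex.Gamma a * (Complex.Gamma (1 - b))⁻¹ * (Complex.Gamma (b + 1))⁻¹ *
      (Complex.Gamma (a + 1))⁻¹ = Complex.sin (Real.pi * b) / (Real.pi * a * b) := by
  rw [Complex.Gamma_add_one a ha, Complex.Gamma_add_one b hb]
  have h := Complex.Gamma_mul_Gamma_one_sub b
  have h' : (Complex.Gamma b)⁻¹ * (Complex.Gamma (1 - b))⁻¹ =
      Complex.sin (Real.pi * b) / Real.pi := by
    rw [← mul_inv, h, inv_div]
  calc _ = (Complex.Gamma a * (Complex.Gamma a)⁻¹) * a⁻¹ * b⁻¹ *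
        ((Complex.Gamma b)⁻¹ * (Complex.Gamma (1 - b))⁻¹) := by
        simp only [mul_inv]; ring
    _ = _ := by
        rw [h', mul_inv_cancel₀ hG]
        simp only [div_eq_mul_inv, mul_inv]; ring

/-- For a positive even integer `k` and `μ ∈ ℂ` such that neither `(μ+k-1)/2` nor
`(-μ+k-1)/2` is a nonpositive integer, we have `𝒢_{μ,k-1}(0) = 𝒢_{-μ,k-1}(0)`. -/
theorem calG_sub_calG_eq_zero_at_zero
    (k : ℕ) (hk : 0 < k) (hke : Even k) (μ : ℂ)
    (h1 : ∀ n : ℕ, (μ + (k : ℂ) - 1) / 2 ≠ -(n : ℂ))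
    (h2 : ∀ n : ℕ, (-μ + (k : ℂ) - 1) / 2 ≠ -(n : ℂ)) :
    calG μ ((k : ℂ) - 1) 0 = calG (-μ) ((k : ℂ) - 1) 0 := by
  obtain ⟨m, rfl⟩ := hke
  have ha := h1 0
  have hb := h2 0
  simp only [Nat.cast_zero, neg_zero] at ha hb
  have e1 := calG_aux _ _ ha hb (Complex.Gamma_ne_zero h1)
  have e2 := calG_aux _ _ hb ha (Complex.Gamma_ne_zero h2)
  have hs : Complex.sin (Real.pi * ((μ + ((m + m : ℕ) : ℂ) - 1) / 2)) =
      Complex.sin (Real.pi * ((-μ + ((m + m : ℕ) : ℂ) - 1) / 2)) := by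
    have : (Real.pi * ((μ + ((m + m : ℕ) : ℂ) - 1) / 2) : ℂ) =
        Real.pi - (Real.pi * ((-μ + ((m + m : ℕ) : ℂ) - 1) / 2)) +
          ((m : ℤ) - 1 : ℤ) * (2 * Real.pi) := by
      push_cast; ring
    rw [this, Complex.sin_add_int_mul_two_pi, Complex.sin_pi_sub]
  rw [hs] at e2
  have e3 := e1.trans (Eq.trans (by congr 1; ring) e2.symm)
  unfold calG
  convert e3 using 1 <;> ring_nf
end

section
/- Let k be a positive even integer and let v ∈ ℂ be a non-integer. Then 𝒢_{v,k−1}(v+1) − 𝒢_{−v,k−1}(v+1) = −(−1)^{k/2} · Γ(v + k/2) · sin(πv) · (1/π) · Γ⁻¹(−v + k/2). -/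
open Complex Real

/-- For a positive even integer `k` and a non-integer `v ∈ ℂ`,
`𝒢_{v,k-1}(v+1) - 𝒢_{-v,k-1}(v+1) = -(-1)^{k/2} Γ(v+k/2) sin(πv) (1/π) Γ⁻¹(-v+k/2)`. -/
theorem calG_sub_calG_at_v_add_one
    (k : ℕ) (hk : 0 < k) (hke : Even k) (v : ℂ) (hv : ∀ n : ℤ, v ≠ (n : ℂ)) :
    calG v ((k : ℂ) - 1) (v + 1) - calG (-v) ((k : ℂ) - 1) (v + 1) =
      -(-1 : ℂ) ^ (k / 2) * Complex.Gamma (v + (k : ℂ) / 2) *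
        Complex.sin ((π : ℂ) * v) * (1 / (π : ℂ)) *
        (Complex.Gamma (-v + (k : ℂ) / 2))⁻¹ := by
  obtain ⟨m, rfl⟩ := hke
  have hm : 0 < m := by omega
  have hk2 : (m + m) / 2 = m := by omega
  have hc : ((m + m : ℕ) : ℂ) / 2 = m := by push_cast; ring
  rw [hk2, hc]
  unfold calG
  have e1 : (v - (((m + m : ℕ) : ℂ) - 1) - (v + 1)) / 2 + 1 = -((m - 1 : ℕ) : ℂ) := by
    rw [Nat.cast_sub hm]; push_cast; ring
  have e2 : (-v + (((m + m : ℕ) : ℂ) - 1) + (v + 1)) / 2 = m := by push_cast; ring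
  have e3 : (-v - (((m + m : ℕ) : ℂ) - 1) - (v + 1)) / 2 + 1 = 1 - (v + m) := by
    push_cast; ring
  have e4 : ((((m + m : ℕ) : ℂ) - 1) - -v - (v + 1)) / 2 + 1 = m := by push_cast; ring
  have e5 : (-v + (((m + m : ℕ) : ℂ) - 1) - (v + 1)) / 2 + 1 = -v + m := by push_cast; ring
  rw [e1, e2, e3, e4, e5, Complex.Gamma_neg_nat_eq_zero]
  have hG : Complex.Gamma (m : ℂ) ≠ 0 :=
    Complex.Gamma_ne_zero_of_re_pos (by simpa using hm)
  have hz : ∀ n : ℕ, v + m ≠ -(n : ℂ) := by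
    intro n h
    apply hv (-(n : ℤ) - m)
    push_cast
    linear_combination h
  have hz' : ∀ n : ℕ, 1 - (v + m) ≠ -(n : ℂ) := by
    intro n h
    apply hv ((n : ℤ) + 1 - m)
    push_cast
    linear_combination -h
  have h1 := Complex.Gamma_ne_zero hz
  have h2 := Complex.Gamma_ne_zero hz'
  have hr := Complex.Gamma_mul_Gamma_one_sub (v + m)
  have hs : Complex.sin ((π : ℂ) * (v + m)) = (-1) ^ m * Complex.sin ((π : ℂ) * v) := by
    rw [← Complex.sin_antiperiodic.add_nat_mul_eq m]; congr 1; ring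
  have hpi : (π : ℂ) ≠ 0 := by exact_mod_cast Real.pi_ne_zero
  have hs0 : Complex.sin ((π : ℂ) * (v + m)) ≠ 0 := by
    intro h
    rw [h, div_zero] at hr
    exact mul_ne_zero h1 h2 hr
  have key : (Complex.Gamma (1 - (v + m)))⁻¹ =
      Complex.Gamma (v + m) * ((-1) ^ m * Complex.sin ((π : ℂ) * v)) / π := by
    rw [← hs]
    rw [eq_div_iff hs0] at hr
    rw [eq_div_iff hpi, inv_mul_eq_iff_eq_mul₀ h2]
    linear_combination -hr
  rw [key]
  field_simp
  simp
end

section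
/- For any fixed positive real numbers c₀ and c₁ there exists a smooth Schwartz function F : ℝ → ℝ such that: F is even; F(x) ≥ 0 for all x ∈ ℝ; F(x) ≥ 1 for all x ∈ [−c₁, c₁]; the Fourier transform 𝓕F is even; and 𝓕F is supported in [−c₀, c₀] (i.e., 𝓕F(t) = 0 whenever |t| > c₀). -/
open Real
open scoped FourierTransform

theorem aux_fourier_even (f : ℝ → ℂ) (hf : ∀ x, f (-x) = f x) (t : ℝ) :
    𝓕 f (-t) = 𝓕 f t := by
  rw [← Real.fourierInv_eq_fourier_neg, Real.fourierInv_eq_fourier_comp_neg]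
  simp only [hf]

theorem aux_fourier_conj (p : ℝ → ℝ) (t : ℝ) :
    (starRingEnd ℂ) (𝓕 (fun x : ℝ => (p x : ℂ)) t) = 𝓕 (fun x : ℝ => (p x : ℂ)) (-t) := by
  rw [Real.fourier_real_eq_integral_exp_smul, Real.fourier_real_eq_integral_exp_smul,
    ← integral_conj]
  congr 1
  ext x
  simp only [smul_eq_mul, map_mul, Complex.conj_ofReal, ← Complex.exp_conj, Complex.conj_I]
  congr 2
  push_cast
  ring

theorem aux_fourier_re (p : ℝ → ℝ) (hp : MeasureTheory.Integrable p) (t : ℝ) :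
    (𝓕 (fun x : ℝ => (p x : ℂ)) t).re = ∫ x, Real.cos (2 * π * x * t) * p x := by
  have hi : MeasureTheory.Integrable (fun x : ℝ => (p x : ℂ)) := hp.ofReal
  have h2 := (Real.fourierIntegral_convergent_iff (V := ℝ) (μ := MeasureTheory.volume) t).2 hi
  rw [Real.fourier_eq]
  have := integral_re h2
  simp only [RCLike.re_eq_complex_re] at this
  rw [← this]
  congr 1
  ext x
  rw [Circle.smul_def, Real.fourierChar_apply, smul_eq_mul, Complex.re_mul_ofReal,
    Complex.exp_ofReal_mul_I_re, mul_neg, Real.cos_neg]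
  simp only [RCLike.inner_apply, conj_trivial]
  congr 2
  ring

/-- **Existence of a majorant test function.**
For any fixed `c₀, c₁ > 0` there is a smooth Schwartz function `F : ℝ → ℝ` that is even,
nonnegative, at least `1` on `[-c₁, c₁]`, whose Fourier transform is even and supported
in `[-c₀, c₀]`. -/
theorem exists_schwartz_majorant (c₀ c₁ : ℝ) (hc₀ : 0 < c₀) (hc₁ : 0 < c₁) :
    ∃ F : SchwartzMap ℝ ℝ,
      (∀ x : ℝ, F (-x) = F x) ∧
      (∀ x : ℝ, 0 ≤ F x) ∧
      (∀ x ∈ Set.Icc (-c₁) c₁, 1 ≤ F x) ∧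
      (∀ t : ℝ, 𝓕 (fun x : ℝ => (F x : ℂ)) (-t) = 𝓕 (fun x : ℝ => (F x : ℂ)) t) ∧
      (∀ t : ℝ, c₀ < |t| → 𝓕 (fun x : ℝ => (F x : ℂ)) t = 0) := by
  obtain ⟨δ, hδ, hδ0, hδ1⟩ : ∃ δ : ℝ, 0 < δ ∧ 2 * δ ≤ c₀ ∧ 2 * π * c₁ * δ ≤ 1 := by
    refine ⟨min (c₀ / 2) (1 / (2 * π * c₁)), by positivity, ?_, ?_⟩
    · linarith [min_le_left (c₀ / 2) (1 / (2 * π * c₁))]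
    · calc 2 * π * c₁ * min (c₀ / 2) (1 / (2 * π * c₁)) ≤ 2 * π * c₁ * (1 / (2 * π * c₁)) := by
            gcongr; exact min_le_right _ _
        _ = 1 := by field_simp
  let b : ContDiffBump (0 : ℝ) := ⟨δ / 2, δ, by positivity, by linarith⟩
  let p : ℝ → ℝ := b.normed MeasureTheory.volume
  have hp_even : ∀ x, p (-x) = p x := fun x => b.normed_neg x
  have hp_nonneg : ∀ x, 0 ≤ p x := fun x => b.nonneg_normed x
  have hp_int : MeasureTheory.Integrable p := b.integrable_normed
  have hp_one : ∫ x, p x = 1 := b.integral_normed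
  have hp_supp : Function.support p = Metric.ball 0 δ := b.support_normed_eq
  have hp_cpt : HasCompactSupport p := b.hasCompactSupport_normed
  have hp_smooth : ContDiff ℝ (⊤ : ℕ∞) p := b.contDiff_normed
  have hq_cpt : HasCompactSupport (fun x => (p x : ℂ)) := hp_cpt.comp_left (g := Complex.ofReal) rfl
  have hq_smooth : ContDiff ℝ (⊤ : ℕ∞) (fun x => (p x : ℂ)) :=
    Complex.ofRealCLM.contDiff.comp hp_smooth
  let φ : SchwartzMap ℝ ℂ := hq_cpt.toSchwartzMap hq_smooth
  have hφ : ∀ x, φ x = p x := fun x => rfl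
  have hφ' : (φ : ℝ → ℂ) = fun x => (p x : ℂ) := rfl
  let B := ContinuousLinearMap.mul ℂ ℂ
  let G : SchwartzMap ℝ ℂ := SchwartzMap.convolution B φ φ
  let h : ℝ → ℂ := 𝓕 (fun x : ℝ => (p x : ℂ))
  have hG : ∀ x, 𝓕 G x = h x * h x := by
    intro x
    simp only [G, SchwartzMap.fourier_convolution]
    rfl
  have h_even : ∀ x, h (-x) = h x := aux_fourier_even _ (fun x => by simp [hp_even])
  have h_real : ∀ x, h x = ((h x).re : ℂ) := by
    intro x
    have h1 : (starRingEnd ℂ) (h x) = h x := (aux_fourier_conj p x).trans (h_even x)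
    exact (Complex.conj_eq_iff_re.1 h1).symm
  have h_low : ∀ x ∈ Set.Icc (-c₁) c₁, 1 / 2 ≤ (h x).re := by
    intro x hx
    simp only [h]
    rw [aux_fourier_re p hp_int]
    calc (1 / 2 : ℝ) = ∫ y, 1 / 2 * p y := by
          rw [MeasureTheory.integral_const_mul, hp_one, mul_one]
      _ ≤ _ := by
        apply MeasureTheory.integral_mono (hp_int.const_mul _)
        · refine hp_int.bdd_mul (c := 1) (by fun_prop) (Filter.Eventually.of_forall fun y => ?_)
          exact Real.abs_cos_le_one _
        · intro y
          by_cases hy : p y = 0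
          · simp [hy]
          · have hy' : y ∈ Metric.ball (0 : ℝ) δ := hp_supp ▸ hy
            rw [mem_ball_zero_iff, Real.norm_eq_abs] at hy'
            have hx' : |x| ≤ c₁ := abs_le.2 hx
            have hb : |2 * π * y * x| ≤ 1 := by
              rw [abs_mul, abs_mul, abs_of_pos (by positivity : 0 < 2 * π)]
              calc 2 * π * |y| * |x| ≤ 2 * π * δ * c₁ := by gcongr
                _ ≤ 1 := by linarith
            have hc := Real.one_sub_sq_div_two_le_cos (x := 2 * π * y * x)
            have hs : (2 * π * y * x) ^ 2 ≤ 1 := (sq_le_one_iff_abs_le_one _).2 hb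
            exact mul_le_mul_of_nonneg_right (by linarith) (hp_nonneg y)
  let F : SchwartzMap ℝ ℝ := (4 : ℝ) • SchwartzMap.postcompCLM Complex.reCLM (𝓕 G)
  have hF : ∀ x, F x = 4 * (h x).re ^ 2 := by
    intro x
    have : F x = 4 * (𝓕 G x).re := rfl
    rw [this, hG, h_real x]
    simp [sq]
  have hFc : (fun x : ℝ => (F x : ℂ)) = ((4 : ℂ) • 𝓕 G : SchwartzMap ℝ ℂ) := by
    ext x
    rw [hF, SchwartzMap.smul_apply, hG, h_real x]
    simp [sq]
  have F_even : ∀ x, F (-x) = F x := fun x => by rw [hF, hF, h_even]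
  refine ⟨F, F_even, fun x => by rw [hF]; positivity, ?_, ?_, ?_⟩
  · intro x hx
    rw [hF]
    nlinarith [h_low x hx]
  · exact aux_fourier_even _ (fun x => by rw [F_even])
  · intro t ht
    rw [hFc, ← SchwartzMap.fourier_coe, FourierTransform.fourier_smul, SchwartzMap.smul_apply]
    have h1 : 𝓕 (𝓕 G) t = G (-t) := by
      have : 𝓕⁻ (𝓕 G) (-t) = G (-t) := by simp
      rw [← this, SchwartzMap.fourierInv_coe, Real.fourierInv_eq_fourier_neg, neg_neg]
      rfl
    rw [h1]
    have h2 : G (-t) = 0 := by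
      simp only [G]
      rw [SchwartzMap.convolution_apply]
      by_contra hne
      obtain ⟨u, hu, v, hv, huv⟩ := MeasureTheory.support_convolution_subset _ hne
      have key : ∀ u, u ∈ Function.support (φ : ℝ → ℂ) → |u| < δ := by
        intro u hu
        have : u ∈ Function.support p := fun h0 => hu (by rw [hφ, h0]; simp)
        rw [hp_supp, mem_ball_zero_iff] at this
        exact this
      have ha := key u hu
      have hb := key v hv
      have hc : |t| ≤ |u| + |v| := by
        rw [← abs_neg t, ← huv]
        exact abs_add_le u v
      linarith
    rw [h2, smul_zero]
end

section
/- Let Φ₁ be an even Schwartz function on ℝ whose Fourier transform 𝓕Φ₁ is compactly supported, and let E₁ : ℂ → ℂ be its entire extension at purely imaginary arguments, E₁(w) := ∫_ℝ 𝓕Φ₁(t) e^{−2πtw} dt. Let U₁ ∈ ℝ, z ∈ ℂ, and δ ∈ ℝ. If δ > Re z, then (1/2π) ∫_ℝ e^{−2πU₁(δ+is)} · E₁(δ+is) / (δ + is − z) ds = ∫_0^∞ 𝓕Φ₁(t + U₁) e^{2πtz} dt. If δ < Re z, then (1/2π) ∫_ℝ e^{−2πU₁(δ+is)} · E₁(δ+is)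 / (δ + is − z) ds = − ∫_0^∞ 𝓕Φ₁(t − U₁) e^{−2πtz} dt. -/
open Real Complex
open scoped FourierTransform

lemma aux_e1 {a b c d : ℂ} (F : ℂ) (h : a + b = c + d) :
    Complex.exp a * F * Complex.exp b = Complex.exp c * F * Complex.exp d := by
  have : Complex.exp a * Complex.exp b = Complex.exp c * Complex.exp d := by
    rw [← Complex.exp_add, h, Complex.exp_add]
  linear_combination F * this

lemma aux_e3 {a b c d F G : ℂ} (hF : F = G) (h : a + b + c = d) :
    Complex.exp a * (F * Complex.exp b * Complex.exp c) = G * Complex.exp d := by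
  rw [← h, Complex.exp_add, Complex.exp_add, hF]
  ring

lemma aux_inv (g : SchwartzMap ℝ ℂ) (V : ℝ) :
    ∫ s : ℝ, Complex.exp (((-2 * π * s * V : ℝ) : ℂ) * Complex.I) * (𝓕 (g : ℝ → ℂ)) s = g (-V) := by
  have h1 : 𝓕⁻ (𝓕 g) = g := FourierTransform.fourierInv_fourier_eq g
  have h2 : (𝓕⁻ (𝓕 (g : ℝ → ℂ))) (-V) = g (-V) := by
    rw [← SchwartzMap.fourier_coe, ← SchwartzMap.fourierInv_coe, h1]
  rw [← h2, Real.fourierInv_eq_fourier_neg, neg_neg, Real.fourier_real_eq_integral_exp_smul]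
  simp only [smul_eq_mul]

lemma aux_main (g : SchwartzMap ℝ ℂ) (c : ℂ) (hc : 0 < c.re) (V σ : ℝ) :
    ∫ s : ℝ, Complex.exp (((-2 * π * s * V : ℝ) : ℂ) * Complex.I) * (𝓕 (g : ℝ → ℂ)) s /
        (c + σ * s * Complex.I) =
      2 * π * ∫ x in Set.Ioi (0 : ℝ), g (-(V + σ * x)) * Complex.exp (-(2 * π * c) * x) := by
  have hpi : (π : ℂ) ≠ 0 := by exact_mod_cast Real.pi_ne_zero
  have hre : ∀ s : ℝ, (-(2 * π * (c + σ * s * Complex.I)) : ℂ).re < 0 := by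
    intro s
    have : (-(2 * π * (c + σ * s * Complex.I)) : ℂ).re = -(2 * π * c.re) := by simp
    rw [this]
    have := Real.pi_pos
    nlinarith [mul_pos this hc]
  have hL : ∀ s : ℝ, Complex.exp (((-2 * π * s * V : ℝ) : ℂ) * Complex.I) * (𝓕 (g : ℝ → ℂ)) s /
        (c + σ * s * Complex.I) = 2 * π * ∫ x in Set.Ioi (0 : ℝ),
          Complex.exp (((-2 * π * s * V : ℝ) : ℂ) * Complex.I) * (𝓕 (g : ℝ → ℂ)) s *
            Complex.exp (-(2 * π * (c + σ * s * Complex.I)) * x) := by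
    intro s
    rw [MeasureTheory.integral_const_mul, integral_exp_mul_complex_Ioi (hre s)]
    have hne : c + σ * s * Complex.I ≠ 0 := by
      intro h0
      have := hre s
      rw [h0] at this
      simp at this
    simp only [Complex.ofReal_zero, mul_zero, Complex.exp_zero]
    field_simp
  have hint : MeasureTheory.Integrable (𝓕 (g : ℝ → ℂ)) := by
    rw [← SchwartzMap.fourier_coe]; exact (𝓕 g).integrable
  simp_rw [hL]
  rw [MeasureTheory.integral_const_mul]
  congr 1
  rw [MeasureTheory.integral_integral_swap]
  · refine MeasureTheory.integral_congr_ae (Filter.Eventually.of_forall fun x => ?_)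
    simp only
    rw [← aux_inv g (V + σ * x), ← MeasureTheory.integral_mul_const]
    congr 1
    ext s
    refine aux_e1 _ ?_
    push_cast
    ring
  · have h0 : (-(2 * π * c) : ℂ).re < 0 := by simpa using hre 0
    have hP := hint.mul_prod (integrableOn_exp_mul_complex_Ioi h0 0)
    refine MeasureTheory.Integrable.congr (hP.bdd_mul (c := 1) (f := fun p : ℝ × ℝ =>
      Complex.exp (((-2 * π * p.1 * (V + σ * p.2) : ℝ) : ℂ) * Complex.I)) ?_ ?_) ?_
    · apply Continuous.aestronglyMeasurable
      fun_prop
    · refine Filter.Eventually.of_forall fun p => ?_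
      rw [Complex.norm_exp_ofReal_mul_I]
    · refine Filter.Eventually.of_forall fun p => ?_
      simp only [Function.uncurry]
      rw [← mul_assoc]
      refine aux_e1 _ ?_
      push_cast
      ring

/-- **Vertical-line integral, first identity (Lemma 11.2, first part).**
Let `Φ₁` be an even real Schwartz function whose Fourier transform is compactly
supported, with entire extension `E₁(w) = ∫ 𝓕Φ₁(t) e^{-2πtw} dt`.  For `U₁ ∈ ℝ`, `z ∈ ℂ`
and `δ ∈ ℝ`:
if `δ > Re z` then `(1/2π) ∫_ℝ e^{-2πU₁(δ+is)} E₁(δ+is)/(δ+is-z) ds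
  = ∫_0^∞ 𝓕Φ₁(t+U₁) e^{2πtz} dt`;
if `δ < Re z` then it equals `-∫_0^∞ 𝓕Φ₁(t-U₁) e^{-2πtz} dt`. -/
theorem vertical_line_integral_one
    (Φ₁ : SchwartzMap ℝ ℝ) (heven : ∀ x : ℝ, Φ₁ (-x) = Φ₁ x)
    (hsupp : HasCompactSupport (𝓕 (fun x : ℝ => (Φ₁ x : ℂ))))
    (E₁ : ℂ → ℂ)
    (hE₁ : ∀ w : ℂ, E₁ w =
      ∫ t : ℝ, 𝓕 (fun x : ℝ => (Φ₁ x : ℂ)) t * Complex.exp (-(2 * (π : ℂ) * (t : ℂ)) * w))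
    (U₁ : ℝ) (z : ℂ) (δ : ℝ) :
    (z.re < δ →
      (1 / (2 * (π : ℂ))) *
          ∫ s : ℝ, Complex.exp (-(2 * (π : ℂ) * (U₁ : ℂ)) * ((δ : ℂ) + (s : ℂ) * Complex.I)) *
            E₁ ((δ : ℂ) + (s : ℂ) * Complex.I) / ((δ : ℂ) + (s : ℂ) * Complex.I - z) =
        ∫ t in Set.Ioi (0 : ℝ),
          𝓕 (fun x : ℝ => (Φ₁ x : ℂ)) (t + U₁) * Complex.exp (2 * (π : ℂ) * (t : ℂ) * z)) ∧
    (δ < z.re →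
      (1 / (2 * (π : ℂ))) *
          ∫ s : ℝ, Complex.exp (-(2 * (π : ℂ) * (U₁ : ℂ)) * ((δ : ℂ) + (s : ℂ) * Complex.I)) *
            E₁ ((δ : ℂ) + (s : ℂ) * Complex.I) / ((δ : ℂ) + (s : ℂ) * Complex.I - z) =
        -∫ t in Set.Ioi (0 : ℝ),
          𝓕 (fun x : ℝ => (Φ₁ x : ℂ)) (t - U₁) * Complex.exp (-(2 * (π : ℂ) * (t : ℂ)) * z)) := by
  set f : ℝ → ℂ := 𝓕 (fun x : ℝ => (Φ₁ x : ℂ)) with hf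
  have hfeven : ∀ x, f (-x) = f x := by
    intro x
    rw [hf, ← Real.fourierInv_eq_fourier_neg, Real.fourierInv_eq_fourier_comp_neg]
    simp only [heven]
  have hfs : ContDiff ℝ (⊤ : ℕ∞) f := by
    have : f = 𝓕 (SchwartzMap.postcompCLM (𝕜 := ℝ) Complex.ofRealCLM Φ₁) := by
      rw [SchwartzMap.fourier_coe]; rfl
    rw [this]
    exact SchwartzMap.smooth _ _
  have hg1 : HasCompactSupport (fun t : ℝ => f t * Complex.exp (-(2 * π * δ * t))) :=
    hsupp.mul_right
  have hg2 : ContDiff ℝ (⊤ : ℕ∞) (fun t : ℝ => f t * Complex.exp (-(2 * π * δ * t))) := by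
    refine hfs.mul (ContDiff.cexp (ContDiff.neg (contDiff_const.mul ?_)))
    exact Complex.ofRealCLM.contDiff
  obtain ⟨g, hg⟩ : ∃ g : SchwartzMap ℝ ℂ, ∀ t : ℝ, g t = f t * Complex.exp (-(2 * π * δ * t)) :=
    ⟨hg1.toSchwartzMap hg2, fun t => rfl⟩
  have hE : ∀ s : ℝ, E₁ (δ + s * Complex.I) = (𝓕 (g : ℝ → ℂ)) s := by
    intro s
    rw [hE₁, Real.fourier_real_eq_integral_exp_smul]
    congr 1
    ext t
    rw [hg, smul_eq_mul, mul_left_comm, ← Complex.exp_add]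
    congr 2
    push_cast
    ring
  have hpi : (π : ℂ) ≠ 0 := by exact_mod_cast Real.pi_ne_zero
  have hexp : ∀ s : ℝ, Complex.exp (-(2 * (π : ℂ) * (U₁ : ℂ)) * ((δ : ℂ) + (s : ℂ) * Complex.I)) =
      Complex.exp (-(2 * π * U₁ * δ)) * Complex.exp (((-2 * π * s * U₁ : ℝ) : ℂ) * Complex.I) := by
    intro s
    rw [← Complex.exp_add]
    congr 1
    push_cast
    ring
  simp_rw [hE, hexp]
  constructor
  · intro h
    have hm := aux_main g (δ - z) (by simpa using h) U₁ 1
    have : ∀ s : ℝ, Complex.exp (-(2 * π * U₁ * δ)) *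
        Complex.exp (((-2 * π * s * U₁ : ℝ) : ℂ) * Complex.I) * (𝓕 (g : ℝ → ℂ)) s /
          (δ + s * Complex.I - z) = Complex.exp (-(2 * π * U₁ * δ)) *
        (Complex.exp (((-2 * π * s * U₁ : ℝ) : ℂ) * Complex.I) * (𝓕 (g : ℝ → ℂ)) s /
          (δ - z + (1 : ℝ) * s * Complex.I)) := by
      intro s
      rw [mul_assoc, mul_div_assoc]
      congr 3
      push_cast
      ring
    simp_rw [this]
    rw [MeasureTheory.integral_const_mul, hm, mul_left_comm, ← mul_assoc (1 / (2 * (π : ℂ))),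
      one_div_mul_cancel (by simp), one_mul, ← MeasureTheory.integral_const_mul]
    congr 1
    ext x
    rw [hg, hfeven]
    refine aux_e3 ?_ ?_
    · congr 1
      ring
    · push_cast
      ring
  · intro h
    have hm := aux_main g (z - δ) (by simpa using h) U₁ (-1)
    have : ∀ s : ℝ, Complex.exp (-(2 * π * U₁ * δ)) *
        Complex.exp (((-2 * π * s * U₁ : ℝ) : ℂ) * Complex.I) * (𝓕 (g : ℝ → ℂ)) s /
          (δ + s * Complex.I - z) = -Complex.exp (-(2 * π * U₁ * δ)) *
        (Complex.exp (((-2 * π * s * U₁ : ℝ) : ℂ) * Complex.I) * (𝓕 (g : ℝ → ℂ)) s /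
          (z - δ + (-1 : ℝ) * s * Complex.I)) := by
      intro s
      have hd : (δ + s * Complex.I - z : ℂ) = -(z - δ + (-1 : ℝ) * s * Complex.I) := by
        push_cast
        ring
      rw [hd, div_neg]
      ring
    simp_rw [this]
    rw [MeasureTheory.integral_const_mul, hm, mul_left_comm, ← mul_assoc (1 / (2 * (π : ℂ))),
      one_div_mul_cancel (by simp), one_mul, neg_mul,
      ← MeasureTheory.integral_const_mul]
    congr 2
    ext x
    rw [hg]
    refine aux_e3 ?_ ?_
    · congr 1
      ring
    · push_cast
      ring
end

section
/- Let Φ₁ and Φ₂ be even Schwartz functions on ℝ whose Fourier transforms 𝓕Φ₁, 𝓕Φ₂ are compactly supported, with entire extensions E_j(w) := ∫_ℝ 𝓕Φ_j(t) e^{−2πtw} dt (j = 1, 2). Let U₁, U₂ ∈ ℝ and δ₁, δ₂ > 0. Then (1/4π²) ∫_ℝ ∫_ℝ e^{−2π( U₁(δ₁+is₁) + U₂(δ₂+is₂) )} · E₁(δ₁+is₁) · E₂(δ₂+is₂) / ( (δ₁+is₁) + (δ₂+is₂) )² ds₁ ds₂ = ∫_0^∞ t · 𝓕Φ₁(t +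 U₁) · 𝓕Φ₂(t + U₂) dt. -/
open Real Complex
open scoped FourierTransform

open MeasureTheory

lemma vli_fourier (Φ : SchwartzMap ℝ ℝ) (heven : ∀ x : ℝ, Φ (-x) = Φ x)
    (hsupp : HasCompactSupport (𝓕 (fun x : ℝ => (Φ x : ℂ))))
    (E : ℂ → ℂ)
    (hE : ∀ w : ℂ, E w =
      ∫ t : ℝ, 𝓕 (fun x : ℝ => (Φ x : ℂ)) t * Complex.exp (-(2 * (π : ℂ) * (t : ℂ)) * w))
    (δ : ℝ) :
    Integrable (fun s : ℝ => E ((δ : ℂ) + (s : ℂ) * Complex.I)) ∧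
    ∀ x : ℝ, ∫ s : ℝ, Complex.exp (-(2 * (π : ℂ) * (x : ℂ)) * ((δ : ℂ) + (s : ℂ) * Complex.I)) *
      E ((δ : ℂ) + (s : ℂ) * Complex.I) = 𝓕 (fun x : ℝ => (Φ x : ℂ)) x := by
  let Ψ : SchwartzMap ℝ ℂ := SchwartzMap.postcompCLM (𝕜 := ℝ) Complex.ofRealCLM Φ
  have hΨ : (fun x : ℝ => (Φ x : ℂ)) = (Ψ : ℝ → ℂ) := by
    ext x; simp [Ψ]
  have hf : 𝓕 (fun x : ℝ => (Φ x : ℂ)) = ((𝓕 Ψ : SchwartzMap ℝ ℂ) : ℝ → ℂ) := by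
    rw [hΨ, SchwartzMap.fourier_coe]
  have hfe : ∀ x, 𝓕 (fun x : ℝ => (Φ x : ℂ)) (-x) = 𝓕 (fun x : ℝ => (Φ x : ℂ)) x := by
    intro x
    rw [← Real.fourierInv_eq_fourier_neg, Real.fourierInv_eq_fourier_comp_neg]
    simp only [heven]
  set f := 𝓕 (fun x : ℝ => (Φ x : ℂ)) with hfdef
  let g : ℝ → ℂ := fun t => f t * Complex.exp (-(2 * (π : ℂ) * (t : ℂ)) * δ)
  have hg1 : HasCompactSupport g := hsupp.mul_right
  have hg2 : ContDiff ℝ (⊤ : ℕ∞) g := by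
    have h1 : ContDiff ℝ (⊤ : ℕ∞) f := by rw [hf]; exact (𝓕 Ψ : SchwartzMap ℝ ℂ).smooth ⊤
    have h2 : ContDiff ℝ (⊤ : ℕ∞) (fun t : ℝ => (t : ℂ)) := Complex.ofRealCLM.contDiff
    have h3 : ContDiff ℝ (⊤ : ℕ∞) (fun t : ℝ => Complex.exp (-(2 * (π : ℂ) * (t : ℂ)) * δ)) := by
      fun_prop
    exact h1.mul h3
  let G : SchwartzMap ℝ ℂ := hg1.toSchwartzMap hg2
  have hG : (G : ℝ → ℂ) = g := rfl
  have hEG : ∀ s : ℝ, E ((δ : ℂ) + (s : ℂ) * Complex.I) = (𝓕 G : SchwartzMap ℝ ℂ) s := by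
    intro s
    rw [hE, SchwartzMap.fourier_coe, Real.fourier_real_eq_integral_exp_smul]
    congr 1
    ext t
    simp only [hG, g, smul_eq_mul]
    rw [mul_left_comm, ← Complex.exp_add]
    congr 2
    push_cast
    ring
  simp only [hEG]
  refine ⟨(𝓕 G : SchwartzMap ℝ ℂ).integrable, fun x => ?_⟩
  have hinv : 𝓕⁻ ((𝓕 G : SchwartzMap ℝ ℂ) : ℝ → ℂ) (-x) = g (-x) := by
    rw [← SchwartzMap.fourierInv_coe, FourierTransform.fourierInv_fourier_eq, hG]
  rw [Real.fourierInv_eq'] at hinv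
  have : ∀ s : ℝ, Complex.exp (-(2 * (π : ℂ) * (x : ℂ)) * ((δ : ℂ) + (s : ℂ) * Complex.I)) *
      (𝓕 G : SchwartzMap ℝ ℂ) s = Complex.exp (-(2 * (π : ℂ) * (x : ℂ)) * δ) *
        (Complex.exp ((↑(2 * π * inner ℝ s (-x)) * Complex.I)) • (𝓕 G : SchwartzMap ℝ ℂ) s) := by
    intro s
    rw [smul_eq_mul, ← mul_assoc, ← Complex.exp_add]
    congr 2
    simp
    ring
  simp_rw [this]
  rw [integral_const_mul, hinv]
  simp only [g]
  rw [mul_left_comm, ← Complex.exp_add, hfe]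
  simp

lemma vli_intOn (b : ℝ) (hb : 0 < b) :
    IntegrableOn (fun t : ℝ => t * Real.exp (-b * t)) (Set.Ioi 0) := by
  have := integrableOn_rpow_mul_exp_neg_mul_rpow (p := 1) (s := 1) (b := b) (by norm_num)
    one_pos hb
  simpa using this

lemma vli_intOnC (a : ℂ) (ha : 0 < a.re) :
    IntegrableOn (fun t : ℝ => (t : ℂ) * Complex.exp (-a * t)) (Set.Ioi 0) := by
  refine Integrable.mono (vli_intOn a.re ha) (by fun_prop) ?_
  refine Filter.Eventually.of_forall fun t => ?_
  simp [Complex.norm_exp]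

lemma vli_laplace (a : ℂ) (ha : 0 < a.re) :
    ∫ t in Set.Ioi (0 : ℝ), (t : ℂ) * Complex.exp (-a * t) = 1 / a ^ 2 := by
  have ha0 : a ≠ 0 := by rintro rfl; simp at ha
  have hd : ∀ t ∈ Set.Ici (0 : ℝ), HasDerivAt
      (fun t : ℝ => -((t : ℂ) / a + 1 / a ^ 2) * Complex.exp (-a * t))
      ((t : ℂ) * Complex.exp (-a * t)) t := by
    intro t _
    have h1 : HasDerivAt (fun t : ℝ => (t : ℂ)) 1 t := Complex.ofRealCLM.hasDerivAt
    have h2 := (((h1.div_const a).add_const (1 / a ^ 2)).neg).mul ((h1.const_mul (-a)).cexp)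
    convert! h2 using 1
    simp only [Pi.neg_apply]
    field_simp
    ring
  have ht : Filter.Tendsto (fun t : ℝ => -((t : ℂ) / a + 1 / a ^ 2) * Complex.exp (-a * t))
      Filter.atTop (nhds 0) := by
    have k1 : Filter.Tendsto (fun t : ℝ => (t : ℂ) * Complex.exp (-a * t))
        Filter.atTop (nhds 0) := by
      rw [tendsto_zero_iff_norm_tendsto_zero]
      have := (tendsto_rpow_mul_exp_neg_mul_atTop_nhds_zero 1 a.re ha)
      refine this.congr' ?_
      filter_upwards [Filter.eventually_ge_atTop 0] with t ht
      simp [Complex.norm_exp, abs_of_nonneg ht]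
    have k2 : Filter.Tendsto (fun t : ℝ => Complex.exp (-a * t))
        Filter.atTop (nhds 0) := by
      rw [tendsto_zero_iff_norm_tendsto_zero]
      have := (tendsto_rpow_mul_exp_neg_mul_atTop_nhds_zero 0 a.re ha)
      refine this.congr' ?_
      filter_upwards [Filter.eventually_ge_atTop 0] with t ht
      simp [Complex.norm_exp]
    have := (k1.const_mul (-(1 / a))).add (k2.const_mul (-(1 / a ^ 2)))
    simp only [mul_zero, add_zero] at this
    refine this.congr fun t => ?_
    ring
  rw [integral_Ioi_of_hasDerivAt_of_tendsto' hd (vli_intOnC a ha) ht]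
  simp

lemma vli_core (h₁ h₂ : ℝ → ℂ) (i₁ : Integrable h₁) (i₂ : Integrable h₂) (δ₁ δ₂ : ℝ)
    (hδ₁ : 0 < δ₁) (hδ₂ : 0 < δ₂) :
    ∫ s₁ : ℝ, ∫ s₂ : ℝ, h₁ s₁ * h₂ s₂ * (1 / (2 * (π : ℂ) * (((δ₁ : ℂ) + (s₁ : ℂ) * Complex.I) +
        ((δ₂ : ℂ) + (s₂ : ℂ) * Complex.I))) ^ 2) =
    ∫ t in Set.Ioi (0 : ℝ), (t : ℂ) *
      (∫ s : ℝ, Complex.exp (-(2 * (π : ℂ) * (t : ℂ)) * ((δ₁ : ℂ) + (s : ℂ) * Complex.I)) * h₁ s) *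
      (∫ s : ℝ, Complex.exp (-(2 * (π : ℂ) * (t : ℂ)) * ((δ₂ : ℂ) + (s : ℂ) * Complex.I)) * h₂ s) := by
  let k : ℝ × ℝ → ℝ → ℂ := fun p t => h₁ p.1 * h₂ p.2 * ((t : ℂ) *
    Complex.exp (-(2 * (π : ℂ) * (((δ₁ : ℂ) + (p.1 : ℂ) * Complex.I) +
        ((δ₂ : ℂ) + (p.2 : ℂ) * Complex.I))) * t))
  have hk : Integrable (Function.uncurry k)
      ((volume.prod volume).prod (volume.restrict (Set.Ioi (0 : ℝ)))) := by
    have hc := vli_intOnC (((2 * π * (δ₁ + δ₂) : ℝ)) : ℂ)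
      (by rw [Complex.ofReal_re]; positivity)
    have := ((i₁.mul_prod i₂).mul_prod hc).mul_bdd (c := 1)
      (g := fun q : (ℝ × ℝ) × ℝ =>
        Complex.exp (((-(2 * π * (q.1.1 + q.1.2) * q.2) : ℝ) : ℂ) * Complex.I))
      (by
        apply Continuous.aestronglyMeasurable
        fun_prop) (Filter.Eventually.of_forall fun q => by rw [Complex.norm_exp_ofReal_mul_I])
    refine this.congr (Filter.Eventually.of_forall fun q => ?_)
    simp only [Function.uncurry, k]
    rw [mul_assoc, mul_assoc (q.2 : ℂ), ← Complex.exp_add]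
    congr 3
    push_cast
    ring
  have hL : ∀ p : ℝ × ℝ, ∫ t in Set.Ioi (0 : ℝ), k p t = h₁ p.1 * h₂ p.2 *
      (1 / (2 * (π : ℂ) * (((δ₁ : ℂ) + (p.1 : ℂ) * Complex.I) +
        ((δ₂ : ℂ) + (p.2 : ℂ) * Complex.I))) ^ 2) := by
    intro p
    simp only [k]
    rw [integral_const_mul, vli_laplace]
    simp
    positivity
  have hI := hk.integral_prod_left
  simp only [Function.uncurry_apply_pair, hL] at hI
  rw [integral_integral (f := fun s₁ s₂ : ℝ => h₁ s₁ * h₂ s₂ * (1 / (2 * (π : ℂ) * (((δ₁ : ℂ) +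
    (s₁ : ℂ) * Complex.I) + ((δ₂ : ℂ) + (s₂ : ℂ) * Complex.I))) ^ 2)) hI]
  simp only [← hL]
  rw [integral_integral_swap hk]
  congr 1
  ext t
  rw [mul_assoc, ← integral_prod_mul, ← integral_const_mul]
  congr 1
  ext p
  simp only [k]
  have : Complex.exp (-(2 * (π : ℂ) * (((δ₁ : ℂ) + (p.1 : ℂ) * Complex.I) +
        ((δ₂ : ℂ) + (p.2 : ℂ) * Complex.I))) * t) =
      Complex.exp (-(2 * (π : ℂ) * (t : ℂ)) * ((δ₁ : ℂ) + (p.1 : ℂ) * Complex.I)) *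
      Complex.exp (-(2 * (π : ℂ) * (t : ℂ)) * ((δ₂ : ℂ) + (p.2 : ℂ) * Complex.I)) := by
    rw [← Complex.exp_add]
    congr 1
    ring
  rw [this]
  ring

lemma vli_shift (h : ℝ → ℂ) (i : Integrable h) (U δ : ℝ) :
    Integrable (fun s : ℝ =>
      Complex.exp (-(2 * (π : ℂ) * (U : ℂ)) * ((δ : ℂ) + (s : ℂ) * Complex.I)) * h s) := by
  refine i.bdd_mul (c := Real.exp (-(2 * π * U * δ))) ?_ ?_
  · apply Continuous.aestronglyMeasurable
    fun_prop
  · refine Filter.Eventually.of_forall fun s => ?_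
    rw [Complex.norm_exp]
    simp

/-- **Vertical-line integral, second identity (Lemma 11.2, second part).**
For even real Schwartz functions `Φ₁, Φ₂` with compactly supported Fourier transforms and
entire extensions `E_j(w) = ∫ 𝓕Φ_j(t) e^{-2πtw} dt`, and `U₁, U₂ ∈ ℝ`, `δ₁, δ₂ > 0`:
`(1/4π²) ∫∫ e^{-2π(U₁w₁+U₂w₂)} E₁(w₁)E₂(w₂)/(w₁+w₂)² ds₁ ds₂
  = ∫_0^∞ t 𝓕Φ₁(t+U₁) 𝓕Φ₂(t+U₂) dt`, where `w_j = δ_j + i s_j`. -/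
theorem vertical_line_integral_two
    (Φ₁ Φ₂ : SchwartzMap ℝ ℝ)
    (heven₁ : ∀ x : ℝ, Φ₁ (-x) = Φ₁ x) (heven₂ : ∀ x : ℝ, Φ₂ (-x) = Φ₂ x)
    (hsupp₁ : HasCompactSupport (𝓕 (fun x : ℝ => (Φ₁ x : ℂ))))
    (hsupp₂ : HasCompactSupport (𝓕 (fun x : ℝ => (Φ₂ x : ℂ))))
    (E₁ E₂ : ℂ → ℂ)
    (hE₁ : ∀ w : ℂ, E₁ w =
      ∫ t : ℝ, 𝓕 (fun x : ℝ => (Φ₁ x : ℂ)) t * Complex.exp (-(2 * (π : ℂ) * (t : ℂ)) * w))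
    (hE₂ : ∀ w : ℂ, E₂ w =
      ∫ t : ℝ, 𝓕 (fun x : ℝ => (Φ₂ x : ℂ)) t * Complex.exp (-(2 * (π : ℂ) * (t : ℂ)) * w))
    (U₁ U₂ : ℝ) (δ₁ δ₂ : ℝ) (hδ₁ : 0 < δ₁) (hδ₂ : 0 < δ₂) :
    (1 / (4 * (π : ℂ) ^ 2)) *
        ∫ s₁ : ℝ, ∫ s₂ : ℝ,
          Complex.exp (-(2 * (π : ℂ)) * ((U₁ : ℂ) * ((δ₁ : ℂ) + (s₁ : ℂ) * Complex.I) +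
              (U₂ : ℂ) * ((δ₂ : ℂ) + (s₂ : ℂ) * Complex.I))) *
            E₁ ((δ₁ : ℂ) + (s₁ : ℂ) * Complex.I) * E₂ ((δ₂ : ℂ) + (s₂ : ℂ) * Complex.I) /
            (((δ₁ : ℂ) + (s₁ : ℂ) * Complex.I) + ((δ₂ : ℂ) + (s₂ : ℂ) * Complex.I)) ^ 2 =
      ∫ t in Set.Ioi (0 : ℝ),
        (t : ℂ) * 𝓕 (fun x : ℝ => (Φ₁ x : ℂ)) (t + U₁) *
          𝓕 (fun x : ℝ => (Φ₂ x : ℂ)) (t + U₂) := by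
  obtain ⟨i₁, e₁⟩ := vli_fourier Φ₁ heven₁ hsupp₁ E₁ hE₁ δ₁
  obtain ⟨i₂, e₂⟩ := vli_fourier Φ₂ heven₂ hsupp₂ E₂ hE₂ δ₂
  have key := vli_core _ _ (vli_shift _ i₁ U₁ δ₁) (vli_shift _ i₂ U₂ δ₂) δ₁ δ₂ hδ₁ hδ₂
  have sh : ∀ (E : ℂ → ℂ) (U δ t s : ℝ),
      Complex.exp (-(2 * (π : ℂ) * (t : ℂ)) * ((δ : ℂ) + (s : ℂ) * Complex.I)) *
      (Complex.exp (-(2 * (π : ℂ) * (U : ℂ)) * ((δ : ℂ) + (s : ℂ) * Complex.I)) *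
        E ((δ : ℂ) + (s : ℂ) * Complex.I)) =
      Complex.exp (-(2 * (π : ℂ) * ((t + U : ℝ) : ℂ)) * ((δ : ℂ) + (s : ℂ) * Complex.I)) *
        E ((δ : ℂ) + (s : ℂ) * Complex.I) := by
    intro E U δ t s
    rw [← mul_assoc, ← Complex.exp_add]
    congr 2
    push_cast
    ring
  simp only [sh, e₁, e₂] at key
  rw [← key, ← integral_const_mul]
  congr 1
  ext s₁
  rw [← integral_const_mul]
  congr 1
  ext s₂
  rw [mul_add (-(2 * (π : ℂ))), Complex.exp_add,
    show -(2 * (π : ℂ)) * ((U₁ : ℂ) * ((δ₁ : ℂ) + (s₁ : ℂ) * Complex.I)) =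
      -(2 * (π : ℂ) * (U₁ : ℂ)) * ((δ₁ : ℂ) + (s₁ : ℂ) * Complex.I) by ring,
    show -(2 * (π : ℂ)) * ((U₂ : ℂ) * ((δ₂ : ℂ) + (s₂ : ℂ) * Complex.I)) =
      -(2 * (π : ℂ) * (U₂ : ℂ)) * ((δ₂ : ℂ) + (s₂ : ℂ) * Complex.I) by ring,
    mul_pow, mul_pow, one_div, one_div, mul_inv, mul_inv, mul_inv, div_eq_mul_inv]
  ring
end

section
/- Let Φ₁ and Φ₂ be even Schwartz functions on ℝ whose Fourier transforms 𝓕Φ₁, 𝓕Φ₂ are compactly supported, with entire extensions E_j(w) := ∫_ℝ 𝓕Φ_j(t) e^{−2πtw} dt (j = 1, 2). Let U₁, U₂ ∈ ℝ and δ₁, δ₂ > 0, and write w₁ = δ₁ + is₁, w₂ = δ₂ + is₂. Then (1/4π²) ∫_ℝ ∫_ℝ e^{−2πU₁w₁ − 2πU₂w₂} · (w₁ − w₂)² / ( w₁ w₂ (w₁ + w₂)² ) · E₁(w₁) E₂(w₂) ds₂ ds₁ = ( ∫_0^∞ 𝓕Φ₁(t + U₁) dt ) · ( ∫_0^∞ 𝓕Φ₂(t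 + U₂) dt ) − 4 ∫_0^∞ t · 𝓕Φ₁(t + U₁) · 𝓕Φ₂(t + U₂) dt. -/
open Real Complex
open scoped FourierTransform

open MeasureTheory in
lemma aux_fourier (Φ : SchwartzMap ℝ ℝ) (heven : ∀ x : ℝ, Φ (-x) = Φ x)
    (hsupp : HasCompactSupport (𝓕 (fun x : ℝ => (Φ x : ℂ)))) (U δ : ℝ) :
    ∃ S : SchwartzMap ℝ ℂ,
      (∀ s : ℝ, S s = Complex.exp (-(2 * (π : ℂ) * (U : ℂ)) * ((δ : ℂ) + (s : ℂ) * Complex.I)) *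
        ∫ t : ℝ, 𝓕 (fun x : ℝ => (Φ x : ℂ)) t *
          Complex.exp (-(2 * (π : ℂ) * (t : ℂ)) * ((δ : ℂ) + (s : ℂ) * Complex.I))) ∧
      ∀ x : ℝ, ∫ s : ℝ, S s * Complex.exp (-(2 * (π : ℂ) * (x : ℂ)) *
        ((δ : ℂ) + (s : ℂ) * Complex.I)) = 𝓕 (fun x : ℝ => (Φ x : ℂ)) (x + U) := by
  set F : ℝ → ℂ := 𝓕 (fun x : ℝ => (Φ x : ℂ)) with hF
  have hFs : ContDiff ℝ (⊤ : ℕ∞) F := by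
    have := (𝓕 (SchwartzMap.postcompCLM (𝕜 := ℝ) Complex.ofRealCLM Φ) : SchwartzMap ℝ ℂ).smooth ⊤
    exact this
  have hFe : ∀ t, F (-t) = F t := by
    intro t
    rw [hF, ← Real.fourierInv_eq_fourier_neg, Real.fourierInv_eq_fourier_comp_neg]
    simp only [heven]
  have hg1 : ContDiff ℝ (⊤ : ℕ∞)
      (fun t : ℝ => F (t + U) * Complex.exp (2 * (π : ℂ) * (δ : ℂ) * (t : ℂ))) := by
    have h0 : ContDiff ℝ (⊤ : ℕ∞) (fun t : ℝ => (t : ℂ)) := Complex.ofRealCLM.contDiff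
    have h1 : ContDiff ℝ (⊤ : ℕ∞) (fun t : ℝ => Complex.exp (2 * (π : ℂ) * (δ : ℂ) * (t : ℂ))) :=
      (contDiff_const.mul h0).cexp
    exact (hFs.comp (contDiff_id.add contDiff_const)).mul h1
  have hg2 : HasCompactSupport
      (fun t : ℝ => F (t + U) * Complex.exp (2 * (π : ℂ) * (δ : ℂ) * (t : ℂ))) := by
    have : HasCompactSupport (fun t : ℝ => F (t + U)) :=
      hsupp.comp_homeomorph (Homeomorph.addRight U)
    exact this.mul_right
  let g : SchwartzMap ℝ ℂ := hg2.toSchwartzMap hg1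
  have hg : ∀ t, g t = F (t + U) * Complex.exp (2 * (π : ℂ) * (δ : ℂ) * (t : ℂ)) := fun t => rfl
  refine ⟨𝓕⁻ g, ?_, ?_⟩
  · intro s
    rw [SchwartzMap.fourierInv_coe, Real.fourierInv_eq_fourier_neg,
      Real.fourier_real_eq_integral_exp_smul, ← integral_const_mul,
      ← integral_neg_eq_self (fun t : ℝ => Complex.exp (-(2 * (π : ℂ) * (U : ℂ)) *
        ((δ : ℂ) + (s : ℂ) * Complex.I)) * (F t *
          Complex.exp (-(2 * (π : ℂ) * (t : ℂ)) * ((δ : ℂ) + (s : ℂ) * Complex.I)))),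
      ← integral_add_right_eq_self (fun x : ℝ => (fun t : ℝ => Complex.exp (-(2 * (π : ℂ) * (U : ℂ)) *
        ((δ : ℂ) + (s : ℂ) * Complex.I)) * (F t *
          Complex.exp (-(2 * (π : ℂ) * (t : ℂ)) * ((δ : ℂ) + (s : ℂ) * Complex.I)))) (-x)) U]
    congr 1
    ext v
    beta_reduce
    rw [hFe, hg, smul_eq_mul, mul_left_comm, mul_left_comm (Complex.exp _) (F _), ← Complex.exp_add,
      ← Complex.exp_add]
    congr 2
    push_cast
    ring
  · intro x
    have h1 : 𝓕 (𝓕⁻ g) x = g x := by rw [FourierTransform.fourier_fourierInv_eq]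
    rw [SchwartzMap.fourier_coe, Real.fourier_real_eq_integral_exp_smul, hg] at h1
    have h2 : F (x + U) = Complex.exp (-(2 * (π : ℂ) * (δ : ℂ) * (x : ℂ))) *
        (F (x + U) * Complex.exp (2 * (π : ℂ) * (δ : ℂ) * (x : ℂ))) := by
      rw [mul_left_comm, ← Complex.exp_add]; simp
    rw [h2, ← h1, ← integral_const_mul]
    congr 1
    ext s
    rw [smul_eq_mul, ← mul_assoc, ← Complex.exp_add, mul_comm]
    congr 2
    push_cast
    ring

open MeasureTheory in
lemma aux_lap_int {a : ℂ} (ha : 0 < a.re) :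
    IntegrableOn (fun x : ℝ => (x : ℂ) * Complex.exp (-a * x)) (Set.Ioi 0) := by
  have h := integrableOn_rpow_mul_exp_neg_mul_rpow (p := 1) (s := 1) (b := a.re)
    (by norm_num) one_pos ha
  refine Integrable.mono' h (by fun_prop) ?_
  refine (ae_restrict_mem measurableSet_Ioi).mono fun x hx => ?_
  have hx : 0 < x := hx
  simp [Complex.norm_exp, abs_of_pos hx]

open MeasureTheory Filter Topology in
lemma aux_lap {a : ℂ} (ha : 0 < a.re) :
    ∫ x in Set.Ioi (0 : ℝ), (x : ℂ) * Complex.exp (-a * x) = 1 / a ^ 2 := by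
  have ha0 : a ≠ 0 := by rintro rfl; simp at ha
  have := integral_Ioi_of_hasDerivAt_of_tendsto' (a := (0 : ℝ)) (m := (0 : ℂ))
    (f := fun x : ℝ => -((x : ℂ) / a + 1 / a ^ 2) * Complex.exp (-a * x))
    (f' := fun x : ℝ => (x : ℂ) * Complex.exp (-a * x)) ?_ (aux_lap_int ha) ?_
  · rw [this]; simp
  · intro x _
    have h0 : HasDerivAt (fun x : ℝ => (x : ℂ)) 1 x := Complex.ofRealCLM.hasDerivAt
    have h := (((h0.div_const a).add_const (1 / a ^ 2)).neg).mul ((h0.const_mul (-a)).cexp)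
    have e : (x : ℂ) * Complex.exp (-a * x) = -(1 / a) * Complex.exp (-a * x) +
        -((x : ℂ) / a + 1 / a ^ 2) * (Complex.exp (-a * x) * (-a * 1)) := by
      field_simp
      ring
    beta_reduce
    rw [e]
    exact h
  · have h1 : Tendsto (fun x : ℝ => (x : ℂ) * Complex.exp (-a * x)) atTop (𝓝 0) := by
      rw [tendsto_zero_iff_norm_tendsto_zero]
      have := Real.tendsto_pow_mul_exp_neg_atTop_nhds_zero 1
      have h := tendsto_rpow_mul_exp_neg_mul_atTop_nhds_zero 1 a.re ha
      refine h.congr' ?_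
      filter_upwards [eventually_gt_atTop 0] with x hx
      simp [Complex.norm_exp, abs_of_pos hx]
    have h2 : Tendsto (fun x : ℝ => Complex.exp (-a * x)) atTop (𝓝 0) := by
      rw [tendsto_zero_iff_norm_tendsto_zero]
      have h := tendsto_rpow_mul_exp_neg_mul_atTop_nhds_zero 0 a.re ha
      refine h.congr' ?_
      filter_upwards [eventually_gt_atTop 0] with x hx
      simp [Complex.norm_exp]
    have := ((h1.div_const a).add (h2.div_const (a ^ 2))).neg
    simp only [zero_div, add_zero, neg_zero] at this
    refine this.congr fun x => ?_
    ring

open MeasureTheory in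
lemma aux_swap {α : Type*} [MeasurableSpace α] (μ : Measure α) [SFinite μ] (H W : α → ℂ)
    (hH : Integrable H μ) (hW : Measurable W) (c : ℝ) (hWc : ∀ a, (W a).re = c)
    (k : ℝ → ℂ) (hk : Measurable k)
    (hki : IntegrableOn (fun x : ℝ => k x * Complex.exp (-(2 * π * c : ℂ) * x)) (Set.Ioi 0)) :
    ∫ a, H a * (∫ x in Set.Ioi (0 : ℝ), k x * Complex.exp (-(2 * π * W a) * x)) ∂μ =
      ∫ x in Set.Ioi (0 : ℝ), k x * ∫ a, H a * Complex.exp (-(2 * π * x) * W a) ∂μ := by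
  simp_rw [← integral_const_mul]
  rw [integral_integral_swap]
  · congr 1; ext x; congr 1; ext a
    rw [mul_left_comm]; congr 3; ring
  · have h := hH.mul_prod hki
    refine h.mono ?_ (Filter.Eventually.of_forall fun z => ?_)
    · have h1 : AEStronglyMeasurable (fun z : α × ℝ => H z.1)
          (μ.prod (volume.restrict (Set.Ioi 0))) := hH.1.comp_fst
      refine h1.mul (Measurable.aestronglyMeasurable ?_)
      fun_prop
    · simp [Function.uncurry, Complex.norm_exp, hWc]

open MeasureTheory in
lemma aux_one {α : Type*} [MeasurableSpace α] (μ : Measure α) [SFinite μ] (H W : α → ℂ)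
    (hH : Integrable H μ) (hW : Measurable W) (c : ℝ) (hc : 0 < c) (hWc : ∀ a, (W a).re = c)
    (f : ℝ → ℂ) (hf : ∀ x : ℝ, ∫ a, H a * Complex.exp (-(2 * π * x) * W a) ∂μ = f x) :
    ∫ a, H a / W a ∂μ = 2 * π * ∫ x in Set.Ioi (0 : ℝ), f x := by
  have hp : (0:ℝ) < 2 * π * c := by positivity
  have h := aux_swap μ H W hH hW c hWc (fun _ => 1) measurable_const (by
    simpa using integrableOn_exp_mul_complex_Ioi (a := -(2 * π * c : ℂ)) (by simpa using hp) 0)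
  simp only [hf, one_mul] at h
  rw [← h, ← integral_const_mul]
  congr 1; ext a
  have hre : (-(2 * π * W a)).re < 0 := by simpa [hWc] using hp
  have hW0 : W a ≠ 0 := by intro h0; have := hWc a; simp [h0] at this; linarith
  rw [integral_exp_mul_complex_Ioi hre]
  have := Complex.ofReal_ne_zero.2 Real.pi_ne_zero
  simp
  field_simp

open MeasureTheory in
lemma aux_two {α : Type*} [MeasurableSpace α] (μ : Measure α) [SFinite μ] (H W : α → ℂ)
    (hH : Integrable H μ) (hW : Measurable W) (c : ℝ) (hc : 0 < c) (hWc : ∀ a, (W a).re = c)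
    (f : ℝ → ℂ) (hf : ∀ x : ℝ, ∫ a, H a * Complex.exp (-(2 * π * x) * W a) ∂μ = f x) :
    ∫ a, H a / W a ^ 2 ∂μ = 4 * π ^ 2 * ∫ x in Set.Ioi (0 : ℝ), x * f x := by
  have hp : (0:ℝ) < 2 * π * c := by positivity
  have h := aux_swap μ H W hH hW c hWc (fun x => (x : ℂ)) Complex.measurable_ofReal
    (aux_lap_int (by simpa using hp))
  simp only [hf] at h
  rw [← h, ← integral_const_mul]
  congr 1; ext a
  have hre : 0 < (2 * π * W a).re := by simpa [hWc] using hp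
  have hW0 : W a ≠ 0 := by intro h0; have := hWc a; simp [h0] at this; linarith
  rw [aux_lap hre]
  have := Complex.ofReal_ne_zero.2 Real.pi_ne_zero
  field_simp
  norm_num

open MeasureTheory in
lemma aux_bdd {α : Type*} [MeasurableSpace α] (μ : Measure α) (H W : α → ℂ)
    (hH : Integrable H μ) (hW : Measurable W) (c : ℝ) (hc : 0 < c) (hWc : ∀ a, (W a).re = c) :
    Integrable (fun a => H a / W a) μ := by
  simp_rw [div_eq_mul_inv]
  refine hH.mul_bdd (c := c⁻¹) hW.inv.aestronglyMeasurable (Filter.Eventually.of_forall fun a => ?_)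
  rw [norm_inv]
  refine inv_anti₀ hc ?_
  rw [← hWc a]
  exact Complex.re_le_norm _

/-- **Vertical-line integral for `𝒥_{1,2}` (Lemma 11.3).**
For even real Schwartz functions `Φ₁, Φ₂` with compactly supported Fourier transforms and
entire extensions `E_j(w) = ∫ 𝓕Φ_j(t) e^{-2πtw} dt`, and `U₁, U₂ ∈ ℝ`, `δ₁, δ₂ > 0`,
writing `w_j = δ_j + i s_j`:
`(1/4π²) ∫∫ e^{-2πU₁w₁-2πU₂w₂} (w₁-w₂)²/(w₁w₂(w₁+w₂)²) E₁(w₁)E₂(w₂) ds₂ ds₁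
  = (∫_0^∞ 𝓕Φ₁(t+U₁) dt)(∫_0^∞ 𝓕Φ₂(t+U₂) dt) - 4∫_0^∞ t 𝓕Φ₁(t+U₁)𝓕Φ₂(t+U₂) dt`. -/
theorem vertical_line_integral_I12
    (Φ₁ Φ₂ : SchwartzMap ℝ ℝ)
    (heven₁ : ∀ x : ℝ, Φ₁ (-x) = Φ₁ x) (heven₂ : ∀ x : ℝ, Φ₂ (-x) = Φ₂ x)
    (hsupp₁ : HasCompactSupport (𝓕 (fun x : ℝ => (Φ₁ x : ℂ))))
    (hsupp₂ : HasCompactSupport (𝓕 (fun x : ℝ => (Φ₂ x : ℂ))))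
    (E₁ E₂ : ℂ → ℂ)
    (hE₁ : ∀ w : ℂ, E₁ w =
      ∫ t : ℝ, 𝓕 (fun x : ℝ => (Φ₁ x : ℂ)) t * Complex.exp (-(2 * (π : ℂ) * (t : ℂ)) * w))
    (hE₂ : ∀ w : ℂ, E₂ w =
      ∫ t : ℝ, 𝓕 (fun x : ℝ => (Φ₂ x : ℂ)) t * Complex.exp (-(2 * (π : ℂ) * (t : ℂ)) * w))
    (U₁ U₂ : ℝ) (δ₁ δ₂ : ℝ) (hδ₁ : 0 < δ₁) (hδ₂ : 0 < δ₂) :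
    (1 / (4 * (π : ℂ) ^ 2)) *
        ∫ s₁ : ℝ, ∫ s₂ : ℝ,
          Complex.exp (-(2 * (π : ℂ) * (U₁ : ℂ)) * ((δ₁ : ℂ) + (s₁ : ℂ) * Complex.I) -
              2 * (π : ℂ) * (U₂ : ℂ) * ((δ₂ : ℂ) + (s₂ : ℂ) * Complex.I)) *
            ((((δ₁ : ℂ) + (s₁ : ℂ) * Complex.I) - ((δ₂ : ℂ) + (s₂ : ℂ) * Complex.I)) ^ 2 /
              (((δ₁ : ℂ) + (s₁ : ℂ) * Complex.I) * ((δ₂ : ℂ) + (s₂ : ℂ) * Complex.I) *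
                (((δ₁ : ℂ) + (s₁ : ℂ) * Complex.I) + ((δ₂ : ℂ) + (s₂ : ℂ) * Complex.I)) ^ 2)) *
            E₁ ((δ₁ : ℂ) + (s₁ : ℂ) * Complex.I) * E₂ ((δ₂ : ℂ) + (s₂ : ℂ) * Complex.I) =
      (∫ t in Set.Ioi (0 : ℝ), 𝓕 (fun x : ℝ => (Φ₁ x : ℂ)) (t + U₁)) *
          (∫ t in Set.Ioi (0 : ℝ), 𝓕 (fun x : ℝ => (Φ₂ x : ℂ)) (t + U₂)) -
        4 * ∫ t in Set.Ioi (0 : ℝ),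
          (t : ℂ) * 𝓕 (fun x : ℝ => (Φ₁ x : ℂ)) (t + U₁) *
            𝓕 (fun x : ℝ => (Φ₂ x : ℂ)) (t + U₂) := by
  obtain ⟨S₁, hS₁, hx₁⟩ := aux_fourier Φ₁ heven₁ hsupp₁ U₁ δ₁
  obtain ⟨S₂, hS₂, hx₂⟩ := aux_fourier Φ₂ heven₂ hsupp₂ U₂ δ₂
  simp only [← hE₁] at hS₁
  simp only [← hE₂] at hS₂
  set F₁ : ℝ → ℂ := 𝓕 (fun x : ℝ => (Φ₁ x : ℂ))
  set F₂ : ℝ → ℂ := 𝓕 (fun x : ℝ => (Φ₂ x : ℂ))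
  let w₁ : ℝ → ℂ := fun s => (δ₁ : ℂ) + (s : ℂ) * Complex.I
  let w₂ : ℝ → ℂ := fun s => (δ₂ : ℂ) + (s : ℂ) * Complex.I
  have hw₁ : ∀ s, (w₁ s).re = δ₁ := fun s => by simp [w₁]
  have hw₂ : ∀ s, (w₂ s).re = δ₂ := fun s => by simp [w₂]
  have hm₁ : Measurable w₁ := by fun_prop
  have hm₂ : Measurable w₂ := by fun_prop
  have hi₁ : MeasureTheory.Integrable (fun s => S₁ s) := S₁.integrable
  have hi₂ : MeasureTheory.Integrable (fun s => S₂ s) := S₂.integrable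
  have hδ : 0 < δ₁ + δ₂ := add_pos hδ₁ hδ₂
  have hP : MeasureTheory.Integrable (fun z : ℝ × ℝ => S₁ z.1 * S₂ z.2)
    (MeasureTheory.volume.prod MeasureTheory.volume) := hi₁.mul_prod hi₂
  have hmW : Measurable (fun z : ℝ × ℝ => w₁ z.1 + w₂ z.2) := by fun_prop
  have hWre : ∀ z : ℝ × ℝ, (w₁ z.1 + w₂ z.2).re = δ₁ + δ₂ := fun z => by simp [hw₁, hw₂]
  have hA : MeasureTheory.Integrable (fun z : ℝ × ℝ => S₁ z.1 / w₁ z.1 * (S₂ z.2 / w₂ z.2))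
    (MeasureTheory.volume.prod MeasureTheory.volume) :=
    (aux_bdd _ _ _ hi₁ hm₁ δ₁ hδ₁ hw₁).mul_prod (aux_bdd _ _ _ hi₂ hm₂ δ₂ hδ₂ hw₂)
  have hB : MeasureTheory.Integrable
      (fun z : ℝ × ℝ => S₁ z.1 * S₂ z.2 / (w₁ z.1 + w₂ z.2) ^ 2)
    (MeasureTheory.volume.prod MeasureTheory.volume) := by
    have := aux_bdd _ _ _ (aux_bdd _ _ _ hP hmW _ hδ hWre) hmW _ hδ hWre
    simpa only [div_div, ← pow_two] using this
  have key : ∀ s₁ s₂ : ℝ,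
      Complex.exp (-(2 * (π : ℂ) * (U₁ : ℂ)) * ((δ₁ : ℂ) + (s₁ : ℂ) * Complex.I) -
              2 * (π : ℂ) * (U₂ : ℂ) * ((δ₂ : ℂ) + (s₂ : ℂ) * Complex.I)) *
            ((((δ₁ : ℂ) + (s₁ : ℂ) * Complex.I) - ((δ₂ : ℂ) + (s₂ : ℂ) * Complex.I)) ^ 2 /
              (((δ₁ : ℂ) + (s₁ : ℂ) * Complex.I) * ((δ₂ : ℂ) + (s₂ : ℂ) * Complex.I) *
                (((δ₁ : ℂ) + (s₁ : ℂ) * Complex.I) + ((δ₂ : ℂ) + (s₂ : ℂ) * Complex.I)) ^ 2)) *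
            E₁ ((δ₁ : ℂ) + (s₁ : ℂ) * Complex.I) * E₂ ((δ₂ : ℂ) + (s₂ : ℂ) * Complex.I) =
      (fun z : ℝ × ℝ => S₁ z.1 / w₁ z.1 * (S₂ z.2 / w₂ z.2) -
        4 * (S₁ z.1 * S₂ z.2 / (w₁ z.1 + w₂ z.2) ^ 2)) (s₁, s₂) := by
    intro s₁ s₂
    have e1 : w₁ s₁ ≠ 0 := by intro h0; have := hw₁ s₁; simp [h0] at this; linarith
    have e2 : w₂ s₂ ≠ 0 := by intro h0; have := hw₂ s₂; simp [h0] at this; linarith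
    have e3 : w₁ s₁ + w₂ s₂ ≠ 0 := by
      intro h0; have := hWre (s₁, s₂); simp [h0] at this; linarith
    change _ = S₁ s₁ / w₁ s₁ * (S₂ s₂ / w₂ s₂) - 4 * (S₁ s₁ * S₂ s₂ / (w₁ s₁ + w₂ s₂) ^ 2)
    rw [hS₁, hS₂, sub_eq_add_neg (-(2 * (π : ℂ) * (U₁ : ℂ)) * _),
      Complex.exp_add, ← neg_mul (2 * (π : ℂ) * (U₂ : ℂ))]
    change _ * ((w₁ s₁ - w₂ s₂) ^ 2 / (w₁ s₁ * w₂ s₂ * (w₁ s₁ + w₂ s₂) ^ 2)) * E₁ (w₁ s₁) *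
      E₂ (w₂ s₂) = Complex.exp (-(2 * (π : ℂ) * (U₁ : ℂ)) * w₁ s₁) * E₁ (w₁ s₁) / w₁ s₁ *
      (Complex.exp (-(2 * (π : ℂ) * (U₂ : ℂ)) * w₂ s₂) * E₂ (w₂ s₂) / w₂ s₂) -
      4 * (Complex.exp (-(2 * (π : ℂ) * (U₁ : ℂ)) * w₁ s₁) * E₁ (w₁ s₁) *
        (Complex.exp (-(2 * (π : ℂ) * (U₂ : ℂ)) * w₂ s₂) * E₂ (w₂ s₂)) / (w₁ s₁ + w₂ s₂) ^ 2)
    change Complex.exp (-(2 * (π : ℂ) * (U₁ : ℂ)) * w₁ s₁) *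
      Complex.exp (-(2 * (π : ℂ) * (U₂ : ℂ)) * w₂ s₂) * _ * _ * _ = _
    generalize Complex.exp (-(2 * (π : ℂ) * (U₁ : ℂ)) * w₁ s₁) = A
    generalize Complex.exp (-(2 * (π : ℂ) * (U₂ : ℂ)) * w₂ s₂) = B
    generalize E₁ (w₁ s₁) = C
    generalize E₂ (w₂ s₂) = D
    generalize w₁ s₁ = u at *
    generalize w₂ s₂ = v at *
    field_simp
    ring
  simp_rw [key]
  rw [MeasureTheory.integral_integral (f := fun s₁ s₂ : ℝ =>
    (fun z : ℝ × ℝ => S₁ z.1 / w₁ z.1 * (S₂ z.2 / w₂ z.2) -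
        4 * (S₁ z.1 * S₂ z.2 / (w₁ z.1 + w₂ z.2) ^ 2)) (s₁, s₂)) (hA.sub (hB.const_mul 4))]
  simp only
  rw [MeasureTheory.integral_sub hA (hB.const_mul 4), MeasureTheory.integral_const_mul,
    MeasureTheory.integral_prod_mul (fun s => S₁ s / w₁ s) (fun s => S₂ s / w₂ s),
    aux_one _ _ _ hi₁ hm₁ δ₁ hδ₁ hw₁ _ hx₁, aux_one _ _ _ hi₂ hm₂ δ₂ hδ₂ hw₂ _ hx₂,
    aux_two _ _ _ hP hmW _ hδ hWre (fun x => F₁ (x + U₁) * F₂ (x + U₂))]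
  · have := Complex.ofReal_ne_zero.2 Real.pi_ne_zero
    simp only [← mul_assoc]
    field_simp
    ring
  · intro x
    rw [← hx₁, ← hx₂, ← MeasureTheory.integral_prod_mul]
    congr 1
    ext z
    rw [mul_add, Complex.exp_add]
    ring
end

section
/- Let Φ be an even Schwartz function on ℝ whose Fourier transform 𝓕Φ is compactly supported, with entire extension E(w) := ∫_ℝ 𝓕Φ(t) e^{−2πtw} dt. Then for every δ > 0, (1/2π) ∫_ℝ E(δ + is) / (δ + is) ds = Φ(0)/2. -/
open Real Complex
open scoped FourierTransform

open MeasureTheory Set in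
theorem vli_aux (h : SchwartzMap ℝ ℂ) (δ : ℝ) (hδ : 0 < δ) :
    ∫ s : ℝ, (𝓕 (h : ℝ → ℂ)) s / ((δ : ℂ) + (s : ℂ) * Complex.I) =
      2 * (π : ℂ) * ∫ u in Ioi (0 : ℝ), Complex.exp (-(2 * π * δ) * u) * h (-u) := by
  have hre : (-(2 * π * δ) : ℂ).re < 0 := by
    have : (-(2 * π * δ) : ℂ) = ((-(2 * π * δ) : ℝ) : ℂ) := by push_cast; ring
    rw [this, Complex.ofReal_re]
    have := Real.pi_pos
    have : 0 < 2 * π * δ := by positivity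
    linarith
  set g : ℝ → ℂ := (Ioi (0 : ℝ)).indicator (fun u : ℝ => Complex.exp (-(2 * π * δ) * u)) with hg
  have hgi : Integrable g :=
    (integrable_indicator_iff measurableSet_Ioi).2 (integrableOn_exp_mul_complex_Ioi hre 0)
  have hFg : ∀ s : ℝ, 2 * (π : ℂ) * 𝓕 g s = 1 / ((δ : ℂ) + (s : ℂ) * Complex.I) := by
    intro s
    have hre2 : (-(2 * π * δ) - 2 * π * s * Complex.I : ℂ).re < 0 := by
      have : (2 * π * s * Complex.I : ℂ) = ((2 * π * s : ℝ) : ℂ) * Complex.I := by push_cast; ring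
      rw [Complex.sub_re, this, Complex.re_ofReal_mul]
      simpa using hre
    have h1 : 𝓕 g s = ∫ u in Ioi (0 : ℝ),
        Complex.exp ((-(2 * π * δ) - 2 * π * s * Complex.I) * u) := by
      rw [Real.fourier_real_eq_integral_exp_smul, ← integral_indicator measurableSet_Ioi]
      congr 1
      ext u
      by_cases hu : u ∈ Ioi (0 : ℝ)
      · simp only [hg, indicator_of_mem hu, smul_eq_mul, ← Complex.exp_add]
        congr 1
        push_cast
        ring
      · simp [hg, indicator_of_notMem hu]
    rw [h1, integral_exp_mul_complex_Ioi hre2]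
    have hne : (δ : ℂ) + (s : ℂ) * Complex.I ≠ 0 := by
      intro h0
      have := congrArg Complex.re h0
      simp at this
      exact hδ.ne' this
    have hpi : (π : ℂ) ≠ 0 := Complex.ofReal_ne_zero.2 Real.pi_ne_zero
    have : (-(2 * π * δ) - 2 * π * s * Complex.I : ℂ) = -(2 * π * (δ + s * Complex.I)) := by ring
    rw [this]
    simp
    field_simp
  have key : ∫ ξ : ℝ, 𝓕 (𝓕 (h : ℝ → ℂ)) ξ * g ξ = ∫ x : ℝ, 𝓕 (h : ℝ → ℂ) x * 𝓕 g x := by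
    have hfi : Integrable (𝓕 (h : ℝ → ℂ)) := by
      rw [← SchwartzMap.fourier_coe]; exact (𝓕 h).integrable
    simpa using! (VectorFourier.integral_fourierIntegral_smul_eq_flip (L := innerₗ ℝ)
      Real.continuous_fourierChar continuous_inner hfi hgi)
  have hinv : ∀ u : ℝ, 𝓕 (𝓕 (h : ℝ → ℂ)) u = h (-u) := by
    intro u
    have := congrFun (h.continuous.fourierInv_fourier_eq h.integrable
      (by rw [← SchwartzMap.fourier_coe]; exact (𝓕 h).integrable)) (-u)
    rw [Real.fourierInv_eq_fourier_neg, neg_neg] at this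
    exact this
  calc _ = ∫ s : ℝ, 2 * (π : ℂ) * (𝓕 (h : ℝ → ℂ) s * 𝓕 g s) := by
        congr 1
        ext s
        rw [div_eq_mul_one_div, ← hFg]
        ring
    _ = _ := by
        rw [integral_const_mul, ← key, ← integral_indicator measurableSet_Ioi]
        congr 2
        ext u
        rw [hinv]
        by_cases hu : u ∈ Ioi (0 : ℝ)
        · simp only [hg, indicator_of_mem hu]; ring
        · simp [hg, indicator_of_notMem hu]

/-- **Vertical-line integral, special case (Lemma 11.2, last part).**
Let `Φ` be an even real Schwartz function whose Fourier transform is compactly supported,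
with entire extension `E(w) = ∫ 𝓕Φ(t) e^{-2πtw} dt`.  Then for every `δ > 0`,
`(1/2π) ∫_ℝ E(δ+is)/(δ+is) ds = Φ(0)/2`. -/
theorem vertical_line_integral_half_value
    (Φ : SchwartzMap ℝ ℝ) (heven : ∀ x : ℝ, Φ (-x) = Φ x)
    (hsupp : HasCompactSupport (𝓕 (fun x : ℝ => (Φ x : ℂ))))
    (E : ℂ → ℂ)
    (hE : ∀ w : ℂ, E w =
      ∫ t : ℝ, 𝓕 (fun x : ℝ => (Φ x : ℂ)) t * Complex.exp (-(2 * (π : ℂ) * (t : ℂ)) * w))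
    (δ : ℝ) (hδ : 0 < δ) :
    (1 / (2 * (π : ℂ))) *
        ∫ s : ℝ, E ((δ : ℂ) + (s : ℂ) * Complex.I) / ((δ : ℂ) + (s : ℂ) * Complex.I) =
      (Φ 0 : ℂ) / 2 := by
  classical
  set φ : ℝ → ℂ := 𝓕 (fun x : ℝ => (Φ x : ℂ)) with hφ
  let Ψ : SchwartzMap ℝ ℂ := SchwartzMap.postcompCLM Complex.ofRealCLM Φ
  have hΨ : (Ψ : ℝ → ℂ) = fun x : ℝ => (Φ x : ℂ) := rfl
  have hφΨ : φ = (𝓕 Ψ : SchwartzMap ℝ ℂ) := by rw [SchwartzMap.fourier_coe, hΨ]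
  have hφi : MeasureTheory.Integrable φ := by rw [hφΨ]; exact (𝓕 Ψ).integrable
  have hsm : ContDiff ℝ (⊤ : ℕ∞) φ := by rw [hφΨ]; exact (𝓕 Ψ).smooth ⊤
  have hφeven : ∀ t, φ (-t) = φ t := by
    intro t
    rw [hφ, Real.fourier_real_eq_integral_exp_smul, Real.fourier_real_eq_integral_exp_smul,
      ← MeasureTheory.integral_neg_eq_self]
    congr 1
    ext x
    rw [heven]
    congr 2
    push_cast
    ring
  have hint : ∫ t, φ t = (Φ 0 : ℂ) := by
    have := congrFun (Ψ.continuous.fourierInv_fourier_eq Ψ.integrable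
      (by rw [← SchwartzMap.fourier_coe]; exact (𝓕 Ψ).integrable)) 0
    rw [Real.fourierInv_eq'] at this
    simpa [hΨ, ← hφ] using this
  have hhsm : ContDiff ℝ (⊤ : ℕ∞)
      (fun t : ℝ => φ t * Complex.exp (-(2 * (π : ℂ) * δ) * (t : ℂ))) := by
    refine hsm.mul (ContDiff.cexp (contDiff_const.mul Complex.ofRealCLM.contDiff))
  have hhs : HasCompactSupport
      (fun t : ℝ => φ t * Complex.exp (-(2 * (π : ℂ) * δ) * (t : ℂ))) := hsupp.mul_right
  let h : SchwartzMap ℝ ℂ := hhs.toSchwartzMap hhsm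
  have hh : ∀ t : ℝ, h t = φ t * Complex.exp (-(2 * (π : ℂ) * δ) * (t : ℂ)) := fun t => rfl
  have hEs : ∀ s : ℝ, E ((δ : ℂ) + (s : ℂ) * Complex.I) = 𝓕 (h : ℝ → ℂ) s := by
    intro s
    rw [hE, Real.fourier_real_eq_integral_exp_smul]
    congr 1
    ext t
    rw [hh, smul_eq_mul, mul_left_comm, ← Complex.exp_add]
    congr 2
    push_cast
    ring
  have hhalf : ∫ u in Set.Ioi (0 : ℝ), φ u = (Φ 0 : ℂ) / 2 := by
    have h1 := intervalIntegral.integral_Iic_add_Ioi (b := (0 : ℝ))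
      hφi.integrableOn hφi.integrableOn
    have h2 := integral_comp_neg_Iic 0 φ
    simp only [hφeven, neg_zero] at h2
    rw [h2, hint] at h1
    rw [← h1]
    ring
  simp_rw [hEs]
  rw [vli_aux h δ hδ]
  have : ∀ u : ℝ, Complex.exp (-(2 * π * δ) * u) * h (-u) = φ u := by
    intro u
    rw [hh, hφeven, mul_left_comm, ← Complex.exp_add]
    simp
  simp_rw [this]
  rw [hhalf]
  have hpi : (π : ℂ) ≠ 0 := Complex.ofReal_ne_zero.2 Real.pi_ne_zero
  field_simp
end

section
/- Let s, z ∈ ℂ with |Re z| < 1/4. For each prime p set A_p(s,z) := (1 − p^{−(1+2z)})^{−1} (1 − p^{−(1−2z)})^{−1} W_p(s,z) and B_p(s,z) := (1 − p^{−(2+2z+s)}) (1 − p^{−(2−2z+s)}) (1 − p^{−(2+s)}) · A_p(s,z). Then: (i) if Re(2z + s) > −3/2 and Re(−2z + s) > −3/2, the infinite product ∏_p B_p(s,z) over all primes converges (the family is multipliable); (ii) if Re s > −1/2, the infinite product ∏_p A_p(s,z) converges and ∏_p A_p(s,z) = ζ(2+s) · ζ(2+2z+s) · ζ(2−2z+s)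 · ∏_p B_p(s,z), where ζ is the Riemann zeta function. -/
/-- The local factor `W_p(s,z)` from Lemma 9.2 of the paper:
`W_p(s,z) = 1 - p^{-(1+2z)} - p^{-(1-2z)} + p^{-(2+2z+s)} + p^{-(2-2z+s)} + p^{-(2+s)}
  - p^{-(3+s)} + p^{-(3+2s)}/(p-1) + p^{-2}`. -/
noncomputable def Wp (p : ℕ) (s z : ℂ) : ℂ :=
  1 - (p : ℂ) ^ (-(1 + 2 * z)) - (p : ℂ) ^ (-(1 - 2 * z)) + (p : ℂ) ^ (-(2 + 2 * z + s)) +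
    (p : ℂ) ^ (-(2 - 2 * z + s)) + (p : ℂ) ^ (-(2 + s)) - (p : ℂ) ^ (-(3 + s)) +
    (p : ℂ) ^ (-(3 + 2 * s)) / ((p : ℂ) - 1) + (p : ℂ) ^ (-(2 : ℂ))

/-- The Euler factor of `F̃(s,z)`. -/
noncomputable def Ap (p : ℕ) (s z : ℂ) : ℂ :=
  (1 - (p : ℂ) ^ (-(1 + 2 * z)))⁻¹ * (1 - (p : ℂ) ^ (-(1 - 2 * z)))⁻¹ * Wp p s z

/-- The Euler factor of `F̃₀(s,z)`. -/
noncomputable def Bp (p : ℕ) (s z : ℂ) : ℂ :=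
  (1 - (p : ℂ) ^ (-(2 + 2 * z + s))) * (1 - (p : ℂ) ^ (-(2 - 2 * z + s))) *
    (1 - (p : ℂ) ^ (-(2 + s))) * Ap p s z

lemma aux_bound (a b X Y T E : ℂ) (r r0 : ℝ) (h0 : r ≤ r0) (h1 : r0 < 1)
    (ha : ‖a‖ ≤ r) (hb : ‖b‖ ≤ r) (hX : ‖X‖ ≤ r) (hY : ‖Y‖ ≤ r) (hT : ‖T‖ ≤ r)
    (hE : ‖E‖ ≤ 3 * r ^ 2) :
    ‖(1 - X) * (1 - Y) * (1 - T) *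
      ((1 - a)⁻¹ * (1 - b)⁻¹ * ((1 - a) * (1 - b) + X + Y + T + E)) - 1‖
      ≤ (25 + 96 * ((1 - r0)⁻¹ * (1 - r0)⁻¹)) * r ^ 2 := by
  have hr : 0 ≤ r := (norm_nonneg a).trans ha
  have hr1 : r ≤ 1 := h0.trans h1.le
  have key : ∀ w : ℂ, ‖w‖ ≤ r → 1 - w ≠ 0 ∧ ‖(1 - w)⁻¹‖ ≤ (1 - r0)⁻¹ ∧ ‖1 - w‖ ≤ 2 := by
    intro w hw
    have h2 : 1 - r0 ≤ ‖1 - w‖ := by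
      have := norm_sub_norm_le (1 : ℂ) w
      rw [norm_one] at this
      linarith
    have h3 : 0 < 1 - r0 := by linarith
    refine ⟨?_, ?_, ?_⟩
    · intro h
      rw [h, norm_zero] at h2
      linarith
    · rw [norm_inv]
      exact inv_anti₀ h3 h2
    · have := norm_sub_le (1 : ℂ) w
      rw [norm_one] at this
      linarith
  obtain ⟨ha0, ha1, -⟩ := key a ha
  obtain ⟨hb0, hb1, -⟩ := key b hb
  obtain ⟨-, -, hX2⟩ := key X hX
  obtain ⟨-, -, hY2⟩ := key Y hY
  obtain ⟨-, -, hT2⟩ := key T hT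
  set M := (1 - r0)⁻¹ * (1 - r0)⁻¹ with hM
  have hM0 : 0 ≤ M := mul_self_nonneg _
  have hD : ‖(1 - a)⁻¹ * (1 - b)⁻¹‖ ≤ M := by
    rw [norm_mul]
    exact mul_le_mul ha1 hb1 (norm_nonneg _) ((norm_nonneg _).trans ha1)
  have e : (1 - X) * (1 - Y) * (1 - T) *
      ((1 - a)⁻¹ * (1 - b)⁻¹ * ((1 - a) * (1 - b) + X + Y + T + E)) - 1 =
      (-((X + Y + T) * (X + Y + T)) + (X * Y + X * T + Y * T - X * Y * T) * (1 + (X + Y + T)))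
      + ((1 - X) * (1 - Y) * (1 - T)) *
        ((((X + Y + T) * (a + b - a * b)) + E) * ((1 - a)⁻¹ * (1 - b)⁻¹)) := by
    field_simp
    ring
  rw [e]
  have mulb : ∀ (u v : ℂ) (x y : ℝ), ‖u‖ ≤ x → ‖v‖ ≤ y → ‖u * v‖ ≤ x * y := by
    intro u v x y hu hv
    rw [norm_mul]
    exact mul_le_mul hu hv (norm_nonneg _) ((norm_nonneg _).trans hu)
  have hS : ‖X + Y + T‖ ≤ 3 * r := by
    have := norm_add₃_le (a := X) (b := Y) (c := T)
    linarith
  have hSS := mulb _ _ _ _ hS hS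
  have hXY := mulb _ _ _ _ hX hY
  have hXYT := mulb _ _ _ _ hXY hT
  have hQ : ‖X * Y + X * T + Y * T - X * Y * T‖ ≤ 4 * r ^ 2 := by
    have h1 := norm_sub_le (X * Y + X * T + Y * T) (X * Y * T)
    have h2 := norm_add₃_le (a := X * Y) (b := X * T) (c := Y * T)
    have h3 := mulb _ _ _ _ hX hT
    have h4 := mulb _ _ _ _ hY hT
    nlinarith [mul_nonneg hr hr]
  have hS1 : ‖1 + (X + Y + T)‖ ≤ 4 := by
    have := norm_add_le (1 : ℂ) (X + Y + T)
    rw [norm_one] at this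
    linarith
  have hab : ‖a + b - a * b‖ ≤ 3 * r := by
    have h1 := norm_sub_le (a + b) (a * b)
    have h2 := norm_add_le a b
    have h3 := mulb _ _ _ _ ha hb
    nlinarith
  have hN := mulb _ _ _ _ (mulb _ _ _ _ hX2 hY2) hT2
  have hSab := mulb _ _ _ _ hS hab
  have hZ : ‖((X + Y + T) * (a + b - a * b)) + E‖ ≤ 12 * r ^ 2 := by
    have := norm_add_le ((X + Y + T) * (a + b - a * b)) E
    nlinarith
  have hfin := mulb _ _ _ _ hN (mulb _ _ _ _ hZ hD)
  have hP : ‖-((X + Y + T) * (X + Y + T)) +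
      (X * Y + X * T + Y * T - X * Y * T) * (1 + (X + Y + T))‖ ≤ 25 * r ^ 2 := by
    have h1 := norm_add_le (-((X + Y + T) * (X + Y + T)))
      ((X * Y + X * T + Y * T - X * Y * T) * (1 + (X + Y + T)))
    rw [norm_neg] at h1
    have h2 := mulb _ _ _ _ hQ hS1
    nlinarith
  refine (norm_add_le _ _).trans ?_
  nlinarith

lemma aux_Bp (s z : ℂ) (hz : |z.re| < 1 / 4) (h1 : -(3 : ℝ) / 2 < (2 * z + s).re)
    (h2 : -(3 : ℝ) / 2 < (-(2 * z) + s).re) :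
    Multipliable fun p : Nat.Primes => Bp (p : ℕ) s z := by
  have h1' : -(3 : ℝ) / 2 < 2 * z.re + s.re := by simpa using h1
  have h2' : -(3 : ℝ) / 2 < -(2 * z.re) + s.re := by simpa using h2
  obtain ⟨hz1, hz2⟩ := abs_lt.mp hz
  obtain ⟨c, hc, c1, c2, c3, c4, c5, c6⟩ : ∃ c : ℝ, 1 / 2 < c ∧ c ≤ 1 ∧ c ≤ 1 + 2 * z.re ∧
      c ≤ 1 - 2 * z.re ∧ c ≤ 2 + 2 * z.re + s.re ∧ c ≤ 2 - 2 * z.re + s.re ∧ c ≤ 2 + s.re := by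
    refine ⟨min 1 (min (1 + 2 * z.re) (min (1 - 2 * z.re) (min (2 + 2 * z.re + s.re)
      (min (2 - 2 * z.re + s.re) (2 + s.re))))), ?_, ?_⟩
    · simp only [lt_min_iff]
      refine ⟨?_, ?_, ?_, ?_, ?_, ?_⟩ <;> linarith
    · simp only [min_le_iff, le_refl, true_or, or_true, and_self]
  have hsum : Summable fun p : Nat.Primes => ((p : ℕ) : ℝ) ^ (-(2 * c)) :=
    Nat.Primes.summable_rpow.mpr (by linarith)
  set r0 : ℝ := (2 : ℝ) ^ (-c) with hr0
  have hr01 : r0 < 1 := Real.rpow_lt_one_of_one_lt_of_neg (by norm_num) (by linarith)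
  have hB : Summable fun p : Nat.Primes => Bp (p : ℕ) s z - 1 := by
    refine Summable.of_norm_bounded
      (hsum.mul_left (25 + 96 * ((1 - r0)⁻¹ * (1 - r0)⁻¹))) ?_
    intro p
    have hp2 : (2 : ℝ) ≤ ((p : ℕ) : ℝ) := by exact_mod_cast p.2.two_le
    have hp0 : (0 : ℝ) < ((p : ℕ) : ℝ) := by linarith
    have hpc : (((p : ℕ) : ℂ)) ≠ 0 := by exact_mod_cast p.2.ne_zero
    set r : ℝ := ((p : ℕ) : ℝ) ^ (-c) with hr
    have hrr : ((p : ℕ) : ℝ) ^ (-(2 * c)) = r ^ 2 := by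
      rw [hr, ← Real.rpow_natCast, ← Real.rpow_mul hp0.le]
      congr 1; push_cast; ring
    have hrr0 : r ≤ r0 := Real.rpow_le_rpow_of_nonpos (by norm_num) hp2 (by linarith)
    have hrpos : 0 < r := Real.rpow_pos_of_pos hp0 _
    have nb : ∀ w : ℂ, c ≤ w.re → ‖((p : ℕ) : ℂ) ^ (-w)‖ ≤ r := by
      intro w hw
      rw [Complex.norm_natCast_cpow_of_pos p.2.pos]
      apply Real.rpow_le_rpow_of_exponent_le (by linarith)
      simpa using hw
    have ha := nb (1 + 2 * z) (by simpa using c2)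
    have hb := nb (1 - 2 * z) (by simpa using c3)
    have hX := nb (2 + 2 * z + s) (by simpa using c4)
    have hY := nb (2 - 2 * z + s) (by simpa using c5)
    have hT := nb (2 + s) (by simpa using c6)
    have hI := nb 1 (by simpa using c1)
    have e1 : ((p : ℕ) : ℂ) ^ (-(3 + s)) = ((p : ℕ) : ℂ) ^ (-(2 + s)) * ((p : ℕ) : ℂ) ^ (-(1:ℂ)) := by
      rw [← Complex.cpow_add _ _ hpc]; congr 1; ring
    have e2 : ((p : ℕ) : ℂ) ^ (-(3 + 2 * s)) =
        ((p : ℕ) : ℂ) ^ (-(2 + s)) * ((p : ℕ) : ℂ) ^ (-(2 + s)) * ((p : ℕ) : ℂ) := by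
      conv_rhs => rw [← Complex.cpow_one ((p : ℕ) : ℂ), Complex.cpow_one ((p : ℕ) : ℂ)]
      nth_rewrite 4 [← Complex.cpow_one ((p : ℕ) : ℂ)]
      rw [← Complex.cpow_add _ _ hpc, ← Complex.cpow_add _ _ hpc]; congr 1; ring
    have e3 : ((p : ℕ) : ℂ) ^ (-(2:ℂ)) =
        ((p : ℕ) : ℂ) ^ (-(1 + 2 * z)) * ((p : ℕ) : ℂ) ^ (-(1 - 2 * z)) := by
      rw [← Complex.cpow_add _ _ hpc]; congr 1; ring
    have hq : ‖((p : ℕ) : ℂ) / (((p : ℕ) : ℂ) - 1)‖ ≤ 2 := by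
      have : ((p : ℕ) : ℂ) / (((p : ℕ) : ℂ) - 1) =
        (((((p : ℕ) : ℝ) / (((p : ℕ) : ℝ) - 1)) : ℝ) : ℂ) := by push_cast; rfl
      rw [this, Complex.norm_real, Real.norm_of_nonneg (div_nonneg hp0.le (by linarith)),
        div_le_iff₀ (by linarith)]
      linarith
    rw [hrr]
    unfold Bp Ap Wp
    rw [e1, e2, e3]
    generalize ((p : ℕ) : ℂ) ^ (-(1 + 2 * z)) = a at *
    generalize ((p : ℕ) : ℂ) ^ (-(1 - 2 * z)) = b at *
    generalize ((p : ℕ) : ℂ) ^ (-(2 + 2 * z + s)) = X at *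
    generalize ((p : ℕ) : ℂ) ^ (-(2 - 2 * z + s)) = Y at *
    generalize ((p : ℕ) : ℂ) ^ (-(2 + s)) = T at *
    generalize ((p : ℕ) : ℂ) ^ (-(1 : ℂ)) = I at *
    have hE : ‖-(T * I) + T * T * (((p : ℕ) : ℂ) / (((p : ℕ) : ℂ) - 1))‖ ≤ 3 * r ^ 2 := by
      refine (norm_add_le _ _).trans ?_
      rw [norm_neg, norm_mul, norm_mul, norm_mul]
      have g1 : ‖T‖ * ‖I‖ ≤ r * r := mul_le_mul hT hI (norm_nonneg _) hrpos.le
      have g2 : ‖T‖ * ‖T‖ ≤ r * r := mul_le_mul hT hT (norm_nonneg _) hrpos.le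
      have g3 := mul_le_mul g2 hq (norm_nonneg _) (by positivity)
      nlinarith
    have := aux_bound a b X Y T _ r r0 hrr0 hr01 ha hb hX hY hT hE
    refine le_of_eq_of_le (congrArg norm ?_) this
    ring
  have := Complex.multipliable_one_add_of_summable hB
  simpa using this

/-- **Convergence of the Euler products `F̃` and `F̃₀` (Lemma 9.2).**
Let `s, z ∈ ℂ` with `|Re z| < 1/4`.  (i) If `Re(2z+s) > -3/2` and `Re(-2z+s) > -3/2`,
then the product `∏_p B_p(s,z)` converges.  (ii) If `Re s > -1/2`, then `∏_p A_p(s,z)`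
converges and equals `ζ(2+s) ζ(2+2z+s) ζ(2-2z+s) ∏_p B_p(s,z)`. -/
theorem euler_products_F_tilde (s z : ℂ) (hz : |z.re| < 1 / 4) :
    ((-(3 : ℝ) / 2 < (2 * z + s).re → -(3 : ℝ) / 2 < (-(2 * z) + s).re →
        Multipliable fun p : Nat.Primes => Bp (p : ℕ) s z)) ∧
    (-(1 : ℝ) / 2 < s.re →
      (Multipliable fun p : Nat.Primes => Ap (p : ℕ) s z) ∧
      (∏' p : Nat.Primes, Ap (p : ℕ) s z) =
        riemannZeta (2 + s) * riemannZeta (2 + 2 * z + s) * riemannZeta (2 - 2 * z + s) *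
          ∏' p : Nat.Primes, Bp (p : ℕ) s z) := by
  have hi := aux_Bp s z hz
  refine ⟨hi, fun hs => ?_⟩
  obtain ⟨hz1, hz2⟩ := abs_lt.mp hz
  have hB := hi (by simp; linarith) (by simp; linarith)
  have r1 : 1 < (2 + s).re := by simp; linarith
  have r2 : 1 < (2 + 2 * z + s).re := by simp; linarith
  have r3 : 1 < (2 - 2 * z + s).re := by simp; linarith
  have H := (((riemannZeta_eulerProduct_hasProd r1).mul
    (riemannZeta_eulerProduct_hasProd r2)).mul (riemannZeta_eulerProduct_hasProd r3)).mul
    hB.hasProd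
  have hA : HasProd (fun p : Nat.Primes => Ap (p : ℕ) s z)
      (riemannZeta (2 + s) * riemannZeta (2 + 2 * z + s) * riemannZeta (2 - 2 * z + s) *
          ∏' p : Nat.Primes, Bp (p : ℕ) s z) := by
    convert H using 2 with p
    have nz : ∀ w : ℂ, 1 < w.re → 1 - ((p : ℕ) : ℂ) ^ (-w) ≠ 0 := by
      intro w hw h
      have h3 : ‖((p : ℕ) : ℂ) ^ (-w)‖ < 1 := by
        rw [Complex.norm_natCast_cpow_of_pos p.2.pos]
        apply Real.rpow_lt_one_of_one_lt_of_neg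
        · exact_mod_cast p.2.one_lt
        · simp only [Complex.neg_re]; linarith
      rw [← sub_eq_zero.mp h, norm_one] at h3
      exact lt_irrefl _ h3
    have n1 := nz _ r1
    have n2 := nz _ r2
    have n3 := nz _ r3
    unfold Bp
    generalize Ap (p : ℕ) s z = A at *
    generalize 1 - ((p : ℕ) : ℂ) ^ (-(2 + 2 * z + s)) = X at *
    generalize 1 - ((p : ℕ) : ℂ) ^ (-(2 - 2 * z + s)) = Y at *
    generalize 1 - ((p : ℕ) : ℂ) ^ (-(2 + s)) = T at *
    field_simp
  exact ⟨hA.multipliable, hA.tprod_eq⟩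
end
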